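/- arXiv:math/0503133 — 5 statements merged into one kernel-verified Lean document; each statement's English description precedes it below -/
import Mathlib

section
/- Let d ≥ 2 and let P(z_1,…,z_d) = Σ_k p_k z_1^{k_1}···z_d^{k_d} be a Laurent polynomial in d variables with complex coefficients that is real-valued and strictly positive on the d-torus, i.e., there exists ε > 0 such that P(z_1,…,z_d) ≥ ε whenever |z_1| = ··· = |z_d| = 1. Then there exist finitely many polynomials Q_1,…,Q_r ∈ ℂ[z_1,…,z_d] (with only nonnegative powers) such that P(z_1,…,z_d) = Σ_{k=1}^r |Q_k(z_1,…,z_d)|² for all z_1,…,z_d on the d-torus. -/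
open Finset

/-- Orthogonality of characters: the `m`-th power sum of the `M`-th roots of unity vanishes for
`0 < |m| < M`. -/
theorem sum_primitiveRoot_zpow {M : ℕ} {ζ : ℂ} (hζ : IsPrimitiveRoot ζ M) {m : ℤ}
    (hm : |m| < M) :
    ∑ j ∈ range M, (ζ ^ j) ^ m = if m = 0 then (M : ℂ) else 0 := by
  split_ifs with h
  · simp [h]
  · have hne : ζ ^ m ≠ 1 := fun h1 =>
      h (Int.eq_zero_of_abs_lt_dvd ((hζ.zpow_eq_one_iff_dvd m).1 h1) hm)
    have hM : (ζ ^ m) ^ M = 1 := by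
      rw [← zpow_natCast, ← zpow_mul, mul_comm, zpow_mul, zpow_natCast, hζ.pow_eq_one, one_zpow]
    have hgeom := mul_geom_sum (ζ ^ m) M
    rw [hM, sub_self] at hgeom
    have hzero := (mul_eq_zero.1 hgeom).resolve_left (sub_ne_zero.2 hne)
    rw [← hzero]
    refine sum_congr rfl fun j _ => ?_
    rw [← zpow_natCast, ← zpow_mul, mul_comm, zpow_mul, zpow_natCast]

/-- The number of pairs in `[0, N)²` with prescribed difference `k`. -/
theorem card_range_product_sub_eq (N : ℕ) (k : ℤ) :
    #{x ∈ range N ×ˢ range N | (x.1 : ℤ) - x.2 = k} = N - k.natAbs := by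
  rw [← card_range (N - k.natAbs)]
  symm
  refine card_bij (fun b _ => (b + k.toNat, b + (-k).toNat)) ?_ ?_ ?_
  · intro b hb
    simp only [mem_range, mem_filter, mem_product] at hb ⊢
    omega
  · intro a _ b _ h
    simp only [Prod.mk.injEq] at h
    omega
  · rintro ⟨a, b⟩ h
    simp only [mem_range, mem_filter, mem_product] at h
    refine ⟨min a b, ?_, ?_⟩
    · simp only [mem_range]; omega
    · simp only [Prod.mk.injEq]; omega

/-- The squared modulus of a geometric sum on the unit circle, expanded as a double sum. -/
theorem normSq_geom_sum_of_norm_eq_one {u : ℂ} (hu : ‖u‖ = 1) (N : ℕ) :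
    (Complex.normSq (∑ a ∈ range N, u ^ a) : ℂ) =
      ∑ x ∈ range N ×ˢ range N, u ^ ((x.1 : ℤ) - x.2) := by
  have hu0 : u ≠ 0 := by
    rintro rfl
    simp at hu
  rw [← Complex.mul_conj, map_sum, sum_mul_sum, sum_product]
  refine sum_congr rfl fun a _ => sum_congr rfl fun b _ => ?_
  rw [map_pow, ← Complex.inv_eq_conj hu, zpow_sub₀ hu0, zpow_natCast, zpow_natCast, inv_pow,
    div_eq_mul_inv]

/-- Discrete convolution of the monomial `z ^ k` with the Fejér kernel multiplies it by
`N - |k|`, up to normalization. -/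
theorem sum_primitiveRoot_mul_fejer {N : ℕ} {ζ : ℂ} (hζ : IsPrimitiveRoot ζ (2 * N))
    {z : ℂ} (hz : ‖z‖ = 1) {k : ℤ} (hk : |k| < N) :
    ∑ j ∈ range (2 * N), (ζ ^ j) ^ k *
        (Complex.normSq (∑ a ∈ range N, ((ζ ^ j)⁻¹ * z) ^ a) : ℂ) =
      (2 * N : ℂ) * (N - k.natAbs : ℕ) * z ^ k := by
  have hN : 2 * N ≠ 0 := by
    have := (abs_nonneg k).trans_lt hk
    omega
  have hζn : ‖ζ‖ = 1 := hζ.norm'_eq_one hN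
  have hζ0 : ζ ≠ 0 := hζ.ne_zero hN
  have step : ∀ j ∈ range (2 * N), (ζ ^ j) ^ k *
      (Complex.normSq (∑ a ∈ range N, ((ζ ^ j)⁻¹ * z) ^ a) : ℂ) =
      ∑ x ∈ range N ×ˢ range N,
        (ζ ^ j) ^ (k - ((x.1 : ℤ) - x.2)) * z ^ ((x.1 : ℤ) - x.2) := by
    intro j _
    rw [normSq_geom_sum_of_norm_eq_one (by simp [hζn, hz]), mul_sum]
    refine sum_congr rfl fun x _ => ?_
    rw [mul_zpow, zpow_sub₀ (pow_ne_zero j hζ0) k, inv_zpow, div_eq_mul_inv, mul_assoc]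
  rw [sum_congr rfl step, sum_comm]
  have inner : ∀ x ∈ range N ×ˢ range N,
      ∑ j ∈ range (2 * N), (ζ ^ j) ^ (k - ((x.1 : ℤ) - x.2)) * z ^ ((x.1 : ℤ) - x.2) =
      if (x.1 : ℤ) - x.2 = k then (2 * N : ℂ) * z ^ k else 0 := by
    intro x hx
    simp only [mem_product, mem_range] at hx
    rw [← sum_mul, sum_primitiveRoot_zpow hζ (by
      rw [abs_lt] at hk ⊢
      push_cast
      omega)]
    by_cases h : (x.1 : ℤ) - x.2 = k
    · simp [h]
    · rw [if_neg (by omega), if_neg h, zero_mul]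
  rw [sum_congr rfl inner, ← sum_filter, sum_const, card_range_product_sub_eq, nsmul_eq_mul]
  ring

/-- Multivariate version of `sum_primitiveRoot_mul_fejer`. -/
theorem sum_primitiveRoot_mul_prod_fejer {d N : ℕ} {ζ : ℂ} (hζ : IsPrimitiveRoot ζ (2 * N))
    {z : Fin d → ℂ} (hz : ∀ i, ‖z i‖ = 1) {k : Fin d → ℤ} (hk : ∀ i, |k i| < N) :
    ∑ j ∈ Fintype.piFinset fun _ : Fin d => range (2 * N), (∏ i, (ζ ^ j i) ^ k i) *
        ∏ i, (Complex.normSq (∑ a ∈ range N, ((ζ ^ j i)⁻¹ * z i) ^ a) : ℂ) =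
      (∏ i, ((2 * N : ℂ) * (N - (k i).natAbs : ℕ))) * ∏ i, z i ^ k i := by
  simp_rw [← prod_mul_distrib]
  rw [← prod_univ_sum (fun _ : Fin d => range (2 * N)) (fun i j => (ζ ^ j) ^ k i *
    (Complex.normSq (∑ a ∈ range N, ((ζ ^ j)⁻¹ * z i) ^ a) : ℂ))]
  exact prod_congr rfl fun i _ => sum_primitiveRoot_mul_fejer hζ (hz i) (hk i)

/-- The Fejér multipliers `∏ (1 - |kᵢ| / N)` tend to `1`. -/
theorem tendsto_fejer_multiplier {d : ℕ} (k : Fin d → ℤ) :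
    Filter.Tendsto (fun N : ℕ => ∏ i, (((N - (k i).natAbs : ℕ) : ℂ) / N))
      Filter.atTop (nhds 1) := by
  have h1 : ∀ i, Filter.Tendsto (fun N : ℕ => (((N - (k i).natAbs : ℕ) : ℂ) / N))
      Filter.atTop (nhds 1) := by
    intro i
    have h0 := tendsto_const_div_atTop_nhds_zero_nat ((k i).natAbs : ℂ)
    have h2 : Filter.Tendsto (fun N : ℕ => 1 - ((k i).natAbs : ℂ) / N)
        Filter.atTop (nhds 1) := by
      simpa using h0.const_sub 1
    refine h2.congr' ?_
    filter_upwards [Filter.eventually_ge_atTop ((k i).natAbs + 1)] with N hN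
    have hN0 : (N : ℂ) ≠ 0 := by
      exact_mod_cast (by omega : N ≠ 0)
    rw [Nat.cast_sub (by omega)]
    field_simp
  simpa using tendsto_finsetProd univ fun i _ => h1 i

/-- A weighted sum of square moduli with nonnegative real weights is a sum of square moduli. -/
theorem exists_sum_normSq_of_nonneg_weights {ι σ : Type*} (T : Finset ι) (c : ι → ℝ)
    (hc : ∀ j ∈ T, 0 ≤ c j) (q : ι → MvPolynomial σ ℂ) :
    ∃ (r : ℕ) (Q : Fin r → MvPolynomial σ ℂ), ∀ z : σ → ℂ,
      ∑ j ∈ T, c j * Complex.normSq (MvPolynomial.eval z (q j)) =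
        ∑ k : Fin r, Complex.normSq (MvPolynomial.eval z (Q k)) := by
  refine ⟨#T, fun n => MvPolynomial.C ((Real.sqrt (c (T.equivFin.symm n)) : ℝ) : ℂ) *
    q (T.equivFin.symm n), fun z => ?_⟩
  rw [← sum_coe_sort T, ← T.equivFin.symm.sum_comp]
  refine sum_congr rfl fun n _ => ?_
  rw [map_mul, MvPolynomial.eval_C, Complex.normSq_mul, Complex.normSq_ofReal,
    Real.mul_self_sqrt (hc _ (T.equivFin.symm n).2)]

/-- Dritschel's theorem (Theorem 2.2 of the paper): a Laurent polynomial in `d ≥ 2` variables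
that is real-valued and strictly positive on the `d`-torus is a finite sum of square magnitudes
of (ordinary) polynomials on the `d`-torus. -/
theorem stmt_0 (d : ℕ) (hd : 2 ≤ d) (S : Finset (Fin d → ℤ)) (p : (Fin d → ℤ) → ℂ)
    (ε : ℝ) (hε : 0 < ε)
    (hpos : ∀ z : Fin d → ℂ, (∀ i, ‖z i‖ = 1) →
      (∑ k ∈ S, p k * ∏ i, z i ^ k i).im = 0 ∧
      ε ≤ (∑ k ∈ S, p k * ∏ i, z i ^ k i).re) :
    ∃ (r : ℕ) (Q : Fin r → MvPolynomial (Fin d) ℂ),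
      ∀ z : Fin d → ℂ, (∀ i, ‖z i‖ = 1) →
        ∑ k ∈ S, p k * ∏ i, z i ^ k i =
          ∑ k : Fin r, (Complex.normSq (MvPolynomial.eval z (Q k)) : ℂ) := by
  let m : ℕ → (Fin d → ℤ) → ℂ := fun N k => ∏ i, (((N - (k i).natAbs : ℕ) : ℂ) / N)
  have hlim : Filter.Tendsto (fun N : ℕ => ∑ k ∈ S, ‖p k / m N k - p k‖)
      Filter.atTop (nhds 0) := by
    rw [← sum_const_zero (s := S)]
    refine tendsto_finsetSum S fun k _ => ?_
    have h := ((tendsto_const_nhds (x := p k)).div (tendsto_fejer_multiplier k) one_ne_zero)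
    have h' := (h.sub_const (p k)).norm
    rwa [div_one, sub_self, norm_zero] at h'
  have hbig : ∀ᶠ N : ℕ in Filter.atTop, ∀ k ∈ S, ∀ i, |k i| < N := by
    rw [Filter.eventually_all_finset]
    refine fun k _ => Filter.eventually_all.2 fun i => ?_
    filter_upwards [Filter.eventually_gt_atTop (k i).natAbs] with N hN
    rw [Int.abs_eq_natAbs]
    exact_mod_cast hN
  obtain ⟨N, hNε, hNk, hN0⟩ := ((hlim.eventually_lt_const hε).and
    (hbig.and (Filter.eventually_gt_atTop 0))).exists
  have hM : 2 * N ≠ 0 := by omega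
  have hNC : (N : ℂ) ≠ 0 := by exact_mod_cast hN0.ne'
  obtain ⟨ζ, hζ⟩ : ∃ ζ : ℂ, IsPrimitiveRoot ζ (2 * N) :=
    ⟨_, Complex.isPrimitiveRoot_exp _ hM⟩
  have hm0 : ∀ k ∈ S, m N k ≠ 0 := by
    refine fun k hk => prod_ne_zero_iff.2 fun i _ => div_ne_zero ?_ hNC
    have := hNk k hk i
    rw [Int.abs_eq_natAbs] at this
    exact_mod_cast (by omega : N - (k i).natAbs ≠ 0)
  let T := Fintype.piFinset fun _ : Fin d => range (2 * N)
  let P' : (Fin d → ℕ) → ℂ := fun j => ∑ k ∈ S, p k / m N k * ∏ i, (ζ ^ j i) ^ k i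
  have hP' : ∀ j, 0 ≤ (P' j).re := by
    intro j
    have hw : ∀ i, ‖ζ ^ j i‖ = 1 := fun i => by simp [hζ.norm'_eq_one hM]
    have hdist : ‖P' j - ∑ k ∈ S, p k * ∏ i, (ζ ^ j i) ^ k i‖ ≤
        ∑ k ∈ S, ‖p k / m N k - p k‖ := by
      rw [← sum_sub_distrib]
      refine (norm_sum_le _ _).trans (sum_le_sum fun k _ => ?_)
      rw [← sub_mul, norm_mul, norm_prod]
      simp [norm_zpow, hζ.norm'_eq_one hM]
    have hre := (abs_le.1 (Complex.abs_re_le_norm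
      (P' j - ∑ k ∈ S, p k * ∏ i, (ζ ^ j i) ^ k i))).1
    have hp := (hpos _ hw).2
    rw [Complex.sub_re] at hre
    linarith
  let q : (Fin d → ℕ) → MvPolynomial (Fin d) ℂ := fun j =>
    ∏ i, ∑ a ∈ range N, (MvPolynomial.C (ζ ^ j i)⁻¹ * MvPolynomial.X i) ^ a
  let c : ℝ := (∏ _i : Fin d, (2 * N * N : ℝ))⁻¹
  obtain ⟨r, Q, hQ⟩ := exists_sum_normSq_of_nonneg_weights T (fun j => c * (P' j).re)
    (fun j _ => mul_nonneg (by positivity) (hP' j)) q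
  refine ⟨r, Q, fun z hz => ?_⟩
  have hq : ∀ j, (Complex.normSq (MvPolynomial.eval z (q j)) : ℂ) =
      ∏ i, (Complex.normSq (∑ a ∈ range N, ((ζ ^ j i)⁻¹ * z i) ^ a) : ℂ) := by
    intro j
    simp [q, map_prod, map_sum]
  have hfejer : ∑ k ∈ S, p k * ∏ i, z i ^ k i =
      ∑ j ∈ T, (c : ℂ) * P' j * (Complex.normSq (MvPolynomial.eval z (q j)) : ℂ) := by
    simp_rw [hq, P', mul_sum, sum_mul]
    rw [sum_comm]
    refine sum_congr rfl fun k hk => ?_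
    have h := sum_primitiveRoot_mul_prod_fejer hζ hz (hNk k hk)
    have hmul : (c : ℂ) * ∏ i, ((2 * N : ℂ) * (N - (k i).natAbs : ℕ)) = m N k := by
      simp only [c, m, Complex.ofReal_inv, Complex.ofReal_prod, ← prod_inv_distrib,
        ← prod_mul_distrib]
      refine prod_congr rfl fun i _ => ?_
      push_cast
      field_simp
    calc p k * ∏ i, z i ^ k i
        = p k / m N k * (m N k * ∏ i, z i ^ k i) := by
          rw [← mul_assoc, div_mul_cancel₀ _ (hm0 k hk)]
      _ = _ := by
          rw [← hmul, mul_assoc (c : ℂ), ← h, mul_sum, mul_sum]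
          exact sum_congr rfl fun j _ => by ring
  rw [← Complex.ofReal_sum, ← hQ z]
  apply Complex.ext
  · rw [hfejer, Complex.ofReal_re, Complex.re_sum]
    refine sum_congr rfl fun j _ => ?_
    rw [Complex.re_mul_ofReal, Complex.re_ofReal_mul]
  · rw [(hpos z hz).1, Complex.ofReal_im]
end

section
/- Let P(z_1,z_2) = Σ_{k=-n_1}^{n_1} p_k(z_2) z_1^k, where each p_k is a Laurent polynomial in z_2 of degree at most n_2, be real-valued and satisfy P(z_1,z_2) ≥ ε > 0 on the bitorus |z_1| = |z_2| = 1. Set C_1 = sup{ |p_k(z_2)| : −n_1 ≤ k ≤ n_1, |z_2| = 1 }, and let m_1 > n_1 be an integer with n_1(n_1+1)C_1/(m_1−n_1) < ε. Then there exist at most m_1 + 1 polynomials Q_1,…,Q_r ∈ ℂ[z_1,z_2] (with only nonnegative powers), each of degree at most m_1 in z_1 and at most n_2 in z_2, such that P(z_1,z_2) = Σ_{k=1}^r |Q_k(z_1,z_2)|² for all |z_1| = |z_2| = 1. -/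
open Finset

section

open scoped ComplexOrder MatrixOrder Matrix

theorem exists_conjTranspose_mul_self_sub_posSemidef {ι κ : Type*} [Fintype ι] [DecidableEq ι]
    [Fintype κ] [DecidableEq κ] {G : Matrix κ κ ℂ} (hG : G.PosSemidef) (s : ι → κ)
    (hD : (G.submatrix s s).PosDef) :
    ∃ F : Matrix ι κ ℂ, IsUnit (F.submatrix id s) ∧ (G - Fᴴ * F).PosSemidef ∧
      ∀ x i, (G - Fᴴ * F) x (s i) = 0 := by
  set D := G.submatrix s s with hDdef
  set B := G.submatrix id s with hBdef
  set E : Matrix κ ι ℂ := (1 : Matrix κ κ ℂ).submatrix id s with hE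
  have hGE : G * E = B := by
    ext x i; simp [hE, hBdef, Matrix.mul_apply, Matrix.one_apply]
  have hEB : Eᴴ * B = D := by
    ext x i; simp [hE, hBdef, hDdef, Matrix.mul_apply, Matrix.one_apply]
  have hEG : Eᴴ * G = Bᴴ := by
    rw [← hGE, Matrix.conjTranspose_mul, hG.isHermitian.eq]
  have hBE : Bᴴ * E = D := by
    rw [← hEG, Matrix.mul_assoc, hGE, hEB]
  have hU : IsUnit D := hD.isUnit
  have hdet : IsUnit D.det := (Matrix.isUnit_iff_isUnit_det D).1 hU
  have hDi : (D⁻¹).IsHermitian := hD.inv.isHermitian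
  obtain ⟨L, hL⟩ := CStarAlgebra.nonneg_iff_eq_star_mul_self.1
    (Matrix.nonneg_iff_posSemidef.2 hD.inv.posSemidef)
  rw [Matrix.star_eq_conjTranspose] at hL
  have hFF : (L * Bᴴ)ᴴ * (L * Bᴴ) = B * D⁻¹ * Bᴴ := by
    rw [Matrix.conjTranspose_mul, Matrix.conjTranspose_conjTranspose, hL]
    simp only [Matrix.mul_assoc]
  have hLU : IsUnit L := by
    rw [Matrix.isUnit_iff_isUnit_det]
    have := (Matrix.isUnit_iff_isUnit_det _).1 hD.inv.isUnit
    rw [hL, Matrix.det_mul] at this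
    exact isUnit_of_mul_isUnit_right this
  refine ⟨L * Bᴴ, ?_, ?_, ?_⟩
  · have : (L * Bᴴ).submatrix id s = L * D := by
      rw [← hBE, ← Matrix.mul_assoc]
      ext x i; simp [hE, Matrix.mul_apply, Matrix.one_apply]
    rw [this]; exact hLU.mul hU
  · have h := hG.conjTranspose_mul_mul_same (1 - E * D⁻¹ * Bᴴ)
    convert h using 1
    rw [hFF]
    have e1 : G * (1 - E * D⁻¹ * Bᴴ) = G - B * D⁻¹ * Bᴴ := by
      rw [Matrix.mul_sub, Matrix.mul_one, ← Matrix.mul_assoc, ← Matrix.mul_assoc, hGE]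
    rw [Matrix.mul_assoc _ G, e1]
    have e2 : (1 - E * D⁻¹ * Bᴴ)ᴴ = 1 - B * D⁻¹ * Eᴴ := by
      simp [Matrix.conjTranspose_mul, hDi.eq, Matrix.mul_assoc]
    rw [e2, Matrix.sub_mul, Matrix.one_mul]
    have e3 : B * D⁻¹ * Eᴴ * (G - B * D⁻¹ * Bᴴ) = 0 := by
      rw [Matrix.mul_assoc, Matrix.mul_sub, hEG, ← Matrix.mul_assoc, ← Matrix.mul_assoc, hEB,
        Matrix.mul_nonsing_inv _ hdet, Matrix.one_mul, sub_self, Matrix.mul_zero]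
    rw [e3, sub_zero]
  · intro x i
    have : (G - B * D⁻¹ * Bᴴ) * E = 0 := by
      rw [Matrix.sub_mul, hGE, Matrix.mul_assoc, hBE, Matrix.mul_assoc,
        Matrix.nonsing_inv_mul _ hdet, Matrix.mul_one, sub_self]
    have h2 := congrFun (congrFun this x) i
    rw [hFF]
    rw [Matrix.mul_apply] at h2
    simpa [hE, Matrix.one_apply] using h2

theorem norm_apply_le_trace {κ : Type*} [Fintype κ] {G : Matrix κ κ ℂ}
    (hG : G.PosSemidef) (x y : κ) : ‖G x y‖ ≤ G.trace.re := by
  have hd : ∀ i, 0 ≤ (G i i).re ∧ 0 = (G i i).im := fun i =>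
    Complex.nonneg_iff.1 hG.diag_nonneg
  have hle : ∀ i, (G i i).re ≤ G.trace.re := fun i => by
    rw [Matrix.trace, Complex.re_sum]
    exact Finset.single_le_sum (f := fun i => (G i i).re) (fun j _ => (hd j).1) (mem_univ i)
  have h := (hG.submatrix ![x, y]).det_nonneg
  rw [Matrix.det_fin_two] at h
  simp only [Matrix.submatrix_apply, Matrix.cons_val_zero, Matrix.cons_val_one] at h
  have hyx : G y x = star (G x y) := (hG.isHermitian.apply y x).symm
  rw [hyx] at h
  have h1 := (Complex.nonneg_iff.1 h).1
  have h2 : (G x y * star (G x y)).re = ‖G x y‖ ^ 2 := by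
    rw [← Complex.normSq_eq_norm_sq, Complex.star_def, Complex.mul_conj, Complex.ofReal_re]
  rw [Complex.sub_re, h2, Complex.mul_re, ← (hd x).2] at h1
  have := hd x; have := hd y; have := hle x; have := hle y
  refine (sq_le_sq₀ (norm_nonneg _) (by linarith)).1 ?_
  nlinarith

theorem isClosed_posSemidef {κ : Type*} [Fintype κ] :
    IsClosed {G : Matrix κ κ ℂ | G.PosSemidef} := by
  have : {G : Matrix κ κ ℂ | G.PosSemidef} =
      {G | Gᴴ = G} ∩ ⋂ x : κ → ℂ, {G | 0 ≤ star x ⬝ᵥ (G *ᵥ x)} := by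
    ext G
    simp [Matrix.posSemidef_iff_dotProduct_mulVec, Matrix.IsHermitian]
  rw [this]
  refine (isClosed_eq (by fun_prop) (by fun_prop)).inter (isClosed_iInter fun x => ?_)
  exact isClosed_le (by fun_prop) (by fun_prop)

/-- The `d`-th block-diagonal sum of a block matrix. -/
def blockDiagSum {ι : Type*} {M : ℕ} (G : Matrix (Fin (M + 1) × ι) (Fin (M + 1) × ι) ℂ) (d : ℤ) :
    Matrix ι ι ℂ :=
  Matrix.of fun i j => ∑ a : Fin (M + 1), ∑ b : Fin (M + 1), if ((b : ℕ) : ℤ) - (a : ℕ) = d then G (a, i) (b, j) else 0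

theorem blockDiagSum_add {ι : Type*} {M : ℕ}
    (G H : Matrix (Fin (M + 1) × ι) (Fin (M + 1) × ι) ℂ) (d : ℤ) :
    blockDiagSum (G + H) d = blockDiagSum G d + blockDiagSum H d := by
  ext i j
  simp only [blockDiagSum, Matrix.of_apply, Matrix.add_apply, ← Finset.sum_add_distrib]
  refine Finset.sum_congr rfl fun a _ => Finset.sum_congr rfl fun b _ => ?_
  split_ifs <;> simp

/-- The cyclic shift of the block index. -/
def blockShift {ι : Type*} {M : ℕ} (x : Fin (M + 1) × ι) : Fin (M + 1) × ι := (x.1 + 1, x.2)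

theorem blockDiagSum_shift {ι : Type*} {M : ℕ}
    {R : Matrix (Fin (M + 1) × ι) (Fin (M + 1) × ι) ℂ}
    (h1 : ∀ x i, R x (0, i) = 0) (h2 : ∀ x i, R (0, i) x = 0) (d : ℤ) :
    blockDiagSum (R.submatrix blockShift blockShift) d = blockDiagSum R d := by
  ext i j
  simp only [blockDiagSum, Matrix.of_apply, Matrix.submatrix_apply, blockShift]
  rw [← Equiv.sum_comp (Equiv.addRight (1 : Fin (M + 1)))
    (fun a => ∑ b : Fin (M + 1), if ((b : ℕ) : ℤ) - (a : ℕ) = d then R (a, i) (b, j) else 0)]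
  refine Finset.sum_congr rfl fun a _ => ?_
  rw [← Equiv.sum_comp (Equiv.addRight (1 : Fin (M + 1)))
    (fun b => if ((b : ℕ) : ℤ) - ((Equiv.addRight (1 : Fin (M + 1)) a : Fin (M + 1)) : ℕ) = d then
      R (Equiv.addRight (1 : Fin (M + 1)) a, i) (b, j) else 0)]
  refine Finset.sum_congr rfl fun b _ => ?_
  simp only [Equiv.coe_addRight]
  by_cases ha : a = Fin.last M
  · simp [ha, h2]
  by_cases hb : b = Fin.last M
  · simp [hb, h1]
  have hd : (((b + 1 : Fin (M + 1)) : ℕ) : ℤ) - ((a + 1 : Fin (M + 1)) : ℕ) = (b : ℕ) - (a : ℕ) := by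
    rw [Fin.val_add_one, Fin.val_add_one, if_neg ha, if_neg hb]
    push_cast
    ring
  simp only [hd]

theorem sum_weight_shift {ι : Type*} [Fintype ι] {M : ℕ}
    {R : Matrix (Fin (M + 1) × ι) (Fin (M + 1) × ι) ℂ} (h1 : ∀ x i, R x (0, i) = 0) :
    ∑ x, ((x.1 : ℕ) : ℝ) * (R (blockShift x) (blockShift x)).re + R.trace.re =
      ∑ x, ((x.1 : ℕ) : ℝ) * (R x x).re := by
  simp only [Matrix.trace, Complex.re_sum, Matrix.diag_apply, Fintype.sum_prod_type, blockShift]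
  rw [← Equiv.sum_comp (Equiv.addRight (1 : Fin (M + 1))) (fun a => ∑ i, (R (a, i) (a, i)).re),
    ← Equiv.sum_comp (Equiv.addRight (1 : Fin (M + 1)))
      (fun a => ∑ i, ((a : ℕ) : ℝ) * (R (a, i) (a, i)).re), ← Finset.sum_add_distrib]
  refine Finset.sum_congr rfl fun a _ => ?_
  rw [← Finset.sum_add_distrib]
  refine Finset.sum_congr rfl fun i _ => ?_
  simp only [Equiv.coe_addRight]
  by_cases ha : a = Fin.last M
  · simp [ha, h1]
  rw [Fin.val_add_one, if_neg ha]
  push_cast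
  ring

theorem isCompact_gram {ι : Type*} [Fintype ι] [DecidableEq ι] {M : ℕ} (T : ℤ → Matrix ι ι ℂ)
    (δ : ℝ) :
    IsCompact {G : Matrix (Fin (M + 1) × ι) (Fin (M + 1) × ι) ℂ | G.PosSemidef ∧
      (G.submatrix (Prod.mk 0) (Prod.mk 0) - (δ : ℂ) • (1 : Matrix ι ι ℂ)).PosSemidef ∧
      ∀ d, blockDiagSum G d = T d} := by
  have hK : IsCompact {G : Matrix (Fin (M + 1) × ι) (Fin (M + 1) × ι) ℂ |
      ∀ x, G x ∈ {g : Fin (M + 1) × ι → ℂ |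
        ∀ y, g y ∈ Metric.closedBall (0 : ℂ) (T 0).trace.re}} :=
    isCompact_pi_infinite fun x => isCompact_pi_infinite fun y => isCompact_closedBall _ _
  refine hK.of_isClosed_subset ?_ ?_
  · refine isClosed_posSemidef.inter (IsClosed.inter ?_ ?_)
    · exact isClosed_posSemidef.preimage (f := fun G : Matrix (Fin (M + 1) × ι) _ ℂ =>
        G.submatrix (Prod.mk 0) (Prod.mk 0) - (δ : ℂ) • (1 : Matrix ι ι ℂ)) (by fun_prop)
    · change IsClosed {G : Matrix (Fin (M + 1) × ι) (Fin (M + 1) × ι) ℂ | ∀ d, blockDiagSum G d = T d}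
      rw [Set.ofPred_forall]
      refine isClosed_iInter fun d => isClosed_eq ?_ continuous_const
      refine continuous_matrix fun i j => ?_
      simp only [blockDiagSum, Matrix.of_apply]
      refine continuous_finsetSum _ fun a _ => continuous_finsetSum _ fun b _ => ?_
      split_ifs <;> fun_prop
  · rintro G ⟨hG, -, hT⟩ x y
    rw [mem_closedBall_zero_iff]
    refine (norm_apply_le_trace hG x y).trans (le_of_eq ?_)
    rw [← hT 0]
    simp only [Matrix.trace, blockDiagSum, Matrix.diag_apply, Matrix.of_apply, sub_eq_zero,
      Nat.cast_inj, Fin.val_inj, Finset.sum_ite_eq', Finset.mem_univ, if_true,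
      Fintype.sum_prod_type]
    rw [Finset.sum_comm]

/-- Matrix Fejér-Riesz: a trigonometric matrix polynomial with a Gram matrix whose leading block
is bounded below is a hermitian square of a polynomial with the same degree bound. -/
theorem exists_factor_of_gram {ι : Type*} [Fintype ι] [DecidableEq ι] {M : ℕ}
    (T : ℤ → Matrix ι ι ℂ) (n : ℕ) (hT : ∀ d : ℤ, n < d → T d = 0) {δ : ℝ} (hδ : 0 < δ)
    (G₀ : Matrix (Fin (M + 1) × ι) (Fin (M + 1) × ι) ℂ) (h₀ : G₀.PosSemidef)
    (h₁ : (G₀.submatrix (Prod.mk 0) (Prod.mk 0) - (δ : ℂ) • (1 : Matrix ι ι ℂ)).PosSemidef)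
    (h₂ : ∀ d, blockDiagSum G₀ d = T d) :
    ∃ F : Matrix ι (Fin (M + 1) × ι) ℂ, (∀ d, blockDiagSum (Fᴴ * F) d = T d) ∧
      ∀ (a : Fin (M + 1)), n < (a : ℕ) → ∀ k i, F k (a, i) = 0 := by
  obtain ⟨G, ⟨hG, hG1, hGT⟩, hmin⟩ := (isCompact_gram T δ).exists_isMinOn ⟨G₀, h₀, h₁, h₂⟩
    (f := fun G : Matrix (Fin (M + 1) × ι) (Fin (M + 1) × ι) ℂ =>
      ∑ x, ((x.1 : ℕ) : ℝ) * (G x x).re) (by fun_prop)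
  have hδ' : (0 : ℂ) < (δ : ℂ) := by exact_mod_cast hδ
  have hD : (G.submatrix (Prod.mk (0 : Fin (M + 1))) (Prod.mk 0) : Matrix ι ι ℂ).PosDef := by
    have := Matrix.PosDef.posSemidef_add hG1 (Matrix.PosDef.one.smul hδ')
    simpa using this
  obtain ⟨F, hFU, hR, hR0⟩ := exists_conjTranspose_mul_self_sub_posSemidef hG _ hD
  set R := G - Fᴴ * F with hRdef
  have hR0' : ∀ x i, R (0, i) x = 0 := fun x i => by
    rw [← hR.isHermitian.apply, hR0, star_zero]
  have hGR : G = Fᴴ * F + R := by rw [hRdef]; abel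
  have hS := hR.submatrix (blockShift (ι := ι) (M := M))
  have hFF := Matrix.posSemidef_conjTranspose_mul_self F
  have hmem := hmin (show Fᴴ * F + R.submatrix blockShift blockShift ∈ _ from ⟨hFF.add hS, by
    have h3 := hG1.add (hS.submatrix (Prod.mk (0 : Fin (M + 1))))
    convert h3 using 1
    ext i j
    have : G (0, i) (0, j) = (Fᴴ * F) (0, i) (0, j) := by
      conv_lhs => rw [hGR]
      rw [Matrix.add_apply, hR0, add_zero]
    simp only [Matrix.sub_apply, Matrix.add_apply, Matrix.submatrix_apply, this]
    ring, fun d => by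
    rw [blockDiagSum_add, blockDiagSum_shift hR0 hR0', ← blockDiagSum_add, ← hGR, hGT]⟩)
  have hRz : R = 0 := by
    rw [← hR.trace_eq_zero_iff]
    have htr := Complex.nonneg_iff.1 hR.trace_nonneg
    refine Complex.ext (le_antisymm ?_ htr.1) htr.2.symm
    have hw := sum_weight_shift hR0
    simp only [Set.mem_ofPred_eq] at hmem
    rw [hGR] at hmem
    simp only [Matrix.add_apply, Complex.add_re, mul_add, Finset.sum_add_distrib,
      Matrix.submatrix_apply] at hmem
    simp only [Complex.zero_re]
    linarith
  rw [hRz, add_zero] at hGR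
  rw [hGR] at hGT
  refine ⟨F, hGT, fun a => ?_⟩
  induction a using WellFoundedGT.induction with
  | ind a ih =>
    intro ha
    have hz : (F.submatrix id (Prod.mk 0))ᴴ * F.submatrix id (Prod.mk a) = 0 := by
      have hd := hGT (a : ℕ)
      rw [hT _ (by exact_mod_cast ha)] at hd
      rw [← hd]
      ext i j
      simp only [blockDiagSum, Matrix.of_apply]
      rw [Finset.sum_eq_single 0, Finset.sum_eq_single a]
      · simp [Matrix.mul_apply]
      · intro b _ hb
        rw [if_neg]
        intro h
        apply hb
        ext
        simp at h
        exact_mod_cast h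
      · simp
      · intro a' _ ha'
        refine Finset.sum_eq_zero fun b _ => ?_
        split_ifs with h
        · have h0 : (a' : ℕ) ≠ 0 := fun h => ha' (Fin.ext h)
          have hab : a < b := by
            rw [Fin.lt_def]; omega
          have := ih b hab (by rw [Fin.lt_def] at hab; omega)
          simp [Matrix.mul_apply, this]
        · rfl
      · simp
    have hU : IsUnit (F.submatrix id (Prod.mk (0 : Fin (M + 1))))ᴴ := by
      rw [← Matrix.star_eq_conjTranspose]; exact hFU.star
    have hFa := (hU.mul_right_eq_zero).1 hz
    intro k i
    exact congrFun (congrFun hFa k) i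

theorem sum_zpow_of_isPrimitiveRoot {L : ℕ} {ω : ℂ} (hω : IsPrimitiveRoot ω L) {d : ℤ}
    (hd : |d| < L) : ∑ s ∈ range L, (ω ^ s) ^ d = if d = 0 then (L : ℂ) else 0 := by
  split_ifs with h
  · simp [h]
  have h1 : ω ^ d ≠ 1 := fun h1 => h (Int.eq_zero_of_abs_lt_dvd ((hω.zpow_eq_one_iff_dvd d).1 h1) hd)
  have h2 : ∀ s : ℕ, (ω ^ s) ^ d = (ω ^ d) ^ s := fun s => by
    rw [← zpow_natCast, ← zpow_natCast, ← zpow_mul, ← zpow_mul, mul_comm]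
  simp only [h2]
  rw [geom_sum_eq h1, ← h2, hω.pow_eq_one, one_zpow, sub_self, zero_div]

/-- The bivariate trigonometric polynomial with coefficients `e`. -/
noncomputable def trigPoly (n m : ℕ) (e : ℤ → ℤ → ℂ) (z w : ℂ) : ℂ :=
  ∑ k ∈ Icc (-(n : ℤ)) n, ∑ l ∈ Icc (-(m : ℤ)) m, e k l * (z ^ k * w ^ l)

theorem toeplitz_posSemidef {n m A B : ℕ} {e : ℤ → ℤ → ℂ}
    (he : ∀ k l, ¬(k ∈ Icc (-(n : ℤ)) n ∧ l ∈ Icc (-(m : ℤ)) m) → e k l = 0)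
    (hf : ∀ z w : ℂ, ‖z‖ = 1 → ‖w‖ = 1 → 0 ≤ trigPoly n m e z w) :
    (Matrix.of fun x y : Fin A × Fin B =>
      e ((y.2 : ℕ) - (x.2 : ℕ)) ((y.1 : ℕ) - (x.1 : ℕ))).PosSemidef := by
  set L : ℕ := n + m + A + B + 1 with hLdef
  have hL : 0 < L := by omega
  have hL' : (L : ℂ) ≠ 0 := by exact_mod_cast hL.ne'
  obtain ⟨ω, hω⟩ : ∃ ω : ℂ, IsPrimitiveRoot ω L := ⟨_, Complex.isPrimitiveRoot_exp L hL.ne'⟩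
  have hn : ∀ s : ℕ, ‖ω ^ s‖ = 1 := fun s => by
    rw [norm_pow, hω.norm'_eq_one hL.ne', one_pow]
  have h0 : ∀ s : ℕ, ω ^ s ≠ 0 := fun s => norm_ne_zero_iff.1 (by rw [hn]; exact one_ne_zero)
  let u : ℕ → ℕ → Fin A × Fin B → ℂ := fun s t x => (ω ^ s) ^ (x.2 : ℕ) * (ω ^ t) ^ (x.1 : ℕ)
  have hsum : (Matrix.of fun x y : Fin A × Fin B =>
      e ((y.2 : ℕ) - (x.2 : ℕ)) ((y.1 : ℕ) - (x.1 : ℕ))) =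
      ∑ s ∈ range L, ∑ t ∈ range L, (trigPoly n m e (ω ^ s) (ω ^ t) * ((L : ℂ)⁻¹ * (L : ℂ)⁻¹)) •
        Matrix.vecMulVec (u s t) (star (u s t)) := by
    ext x y
    obtain ⟨a, j⟩ := x
    obtain ⟨b, j'⟩ := y
    simp only [Matrix.of_apply, Matrix.sum_apply, Matrix.smul_apply, Matrix.vecMulVec_apply,
      Pi.star_apply, smul_eq_mul]
    have hterm : ∀ s t : ℕ, trigPoly n m e (ω ^ s) (ω ^ t) * ((L : ℂ)⁻¹ * (L : ℂ)⁻¹) *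
        (u s t (a, j) * star (u s t (b, j'))) =
        ∑ k ∈ Icc (-(n : ℤ)) n, ∑ l ∈ Icc (-(m : ℤ)) m, e k l * (L : ℂ)⁻¹ * (L : ℂ)⁻¹ *
          ((ω ^ s) ^ (k - ((j' : ℕ) - (j : ℕ))) * (ω ^ t) ^ (l - ((b : ℕ) - (a : ℕ)))) := by
      intro s t
      have hst : ∀ s : ℕ, star (ω ^ s) = (ω ^ s)⁻¹ := fun s => by
        rw [Complex.inv_eq_conj (hn s)]; rfl
      simp only [trigPoly, Finset.sum_mul, u, star_mul', star_pow (ω ^ s), star_pow (ω ^ t), hst]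
      refine Finset.sum_congr rfl fun k _ => Finset.sum_congr rfl fun l _ => ?_
      have e1 : ∀ (s : ℕ) (k : ℤ) (p q : ℕ), (ω ^ s) ^ (k - ((p : ℤ) - (q : ℤ))) =
          (ω ^ s) ^ k * (ω ^ s) ^ q * ((ω ^ s)⁻¹) ^ p := fun s k p q => by
        rw [show k - ((p : ℤ) - q) = k + q + -p by ring, zpow_add₀ (h0 s), zpow_add₀ (h0 s),
          zpow_neg, zpow_natCast, zpow_natCast, inv_pow]
      rw [e1, e1]
      ring
    simp only [hterm]
    have hswap : ∀ g : ℕ → ℕ → ℤ → ℤ → ℂ,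
        ∑ s ∈ range L, ∑ t ∈ range L, ∑ k ∈ Icc (-(n : ℤ)) n, ∑ l ∈ Icc (-(m : ℤ)) m, g s t k l =
        ∑ k ∈ Icc (-(n : ℤ)) n, ∑ l ∈ Icc (-(m : ℤ)) m, ∑ s ∈ range L, ∑ t ∈ range L,
          g s t k l := by
      intro g
      simp only [Finset.sum_comm (s := range L) (t := Icc _ _)]
    rw [hswap]
    have hin : ∀ k ∈ Icc (-(n : ℤ)) n, ∀ l ∈ Icc (-(m : ℤ)) m,
        ∑ s ∈ range L, ∑ t ∈ range L, e k l * (L : ℂ)⁻¹ * (L : ℂ)⁻¹ *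
          ((ω ^ s) ^ (k - ((j' : ℕ) - (j : ℕ))) * (ω ^ t) ^ (l - ((b : ℕ) - (a : ℕ)))) =
        if k = ((j' : ℕ) : ℤ) - (j : ℕ) then if l = ((b : ℕ) : ℤ) - (a : ℕ) then e k l else 0
          else 0 := by
      intro k hk l hl
      simp only [← Finset.mul_sum, ← Finset.sum_mul]
      rw [mem_Icc] at hk hl
      have := a.2; have := b.2; have := j.2; have := j'.2
      rw [sum_zpow_of_isPrimitiveRoot hω (by rw [abs_lt]; constructor <;> omega),
        sum_zpow_of_isPrimitiveRoot hω (by rw [abs_lt]; constructor <;> omega)]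
      simp only [sub_eq_zero]
      split_ifs
      · field_simp
      all_goals simp
    rw [Finset.sum_congr rfl fun k hk => Finset.sum_congr rfl fun l hl => hin k hk l hl]
    by_cases h : (((j' : ℕ) : ℤ) - (j : ℕ) ∈ Icc (-(n : ℤ)) n ∧
      ((b : ℕ) : ℤ) - (a : ℕ) ∈ Icc (-(m : ℤ)) m)
    · rw [Finset.sum_eq_single_of_mem _ h.1, Finset.sum_eq_single_of_mem _ h.2]
      · simp
      · intro l _ hl; simp [hl]
      · intro k _ hk; simp [hk]
    · rw [he _ _ h]
      symm
      refine Finset.sum_eq_zero fun k hk => Finset.sum_eq_zero fun l hl => ?_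
      split_ifs with h1 h2
      · exact absurd ⟨h1 ▸ hk, h2 ▸ hl⟩ h
      all_goals rfl
  rw [hsum]
  refine Matrix.posSemidef_sum _ fun s _ => Matrix.posSemidef_sum _ fun t _ => ?_
  refine (Matrix.posSemidef_vecMulVec_self_star _).smul (mul_nonneg (hf _ _ (hn s) (hn t)) ?_)
  have : (0 : ℂ) ≤ (L : ℂ)⁻¹ := by
    rw [← Complex.ofReal_natCast, ← Complex.ofReal_inv]
    exact_mod_cast inv_nonneg.2 (Nat.cast_nonneg L)
  exact mul_nonneg this this

theorem sum_Icc_abs (n : ℕ) : ∑ k ∈ Icc (-(n : ℤ)) n, |(k : ℝ)| = n * (n + 1) := by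
  induction n with
  | zero => simp
  | succ n ih =>
    have : Icc (-((n + 1 : ℕ) : ℤ)) ((n + 1 : ℕ) : ℤ) =
        insert (-((n + 1 : ℕ) : ℤ)) (insert ((n + 1 : ℕ) : ℤ) (Icc (-(n : ℤ)) n)) := by
      ext k; simp only [mem_insert, mem_Icc]; omega
    rw [this, sum_insert, sum_insert, ih]
    · push_cast
      rw [abs_neg, abs_of_nonneg (by positivity)]; ring
    · simp
    · simp only [mem_insert, mem_Icc]; omega

theorem sum_diff_eq {m : ℕ} {d : ℤ} (hd : |d| ≤ m) (g : ℂ) :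
    ∑ a : Fin m, ∑ b : Fin m, (if ((b : ℕ) : ℤ) - (a : ℕ) = d then g else 0) =
      ((m : ℂ) - (|d| : ℤ)) * g := by
  have key : ∀ k : ℕ, k ≤ m → ∑ a : Fin m, ∑ b : Fin m,
      (if (b : ℕ) = (a : ℕ) + k then g else 0) = ((m : ℂ) - k) * g := by
    intro k hk
    have : ∀ a ∈ range m, ∑ b ∈ range m, (if b = a + k then g else 0) =
        if a ∈ range (m - k) then g else 0 := by
      intro a _
      rw [Finset.sum_ite_eq']
      refine if_congr ?_ rfl rfl
      simp only [mem_range]; omega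
    rw [Fin.sum_univ_eq_sum_range (fun a => ∑ b : Fin m, (if (b : ℕ) = a + k then g else 0)),
      Finset.sum_congr rfl fun a ha =>
        (Fin.sum_univ_eq_sum_range (fun b => if b = a + k then g else 0) m).trans (this a ha),
      Finset.sum_ite_mem, Finset.inter_eq_right.2 (range_subset_range.2 (Nat.sub_le m k))]
    simp [Nat.cast_sub hk]
  rcases le_total 0 d with h | h
  · lift d to ℕ using h
    have := key d (by simpa using hd)
    simp only [Nat.abs_cast, Int.cast_natCast]
    rw [← this]
    refine Finset.sum_congr rfl fun a _ => Finset.sum_congr rfl fun b _ => if_congr ?_ rfl rfl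
    omega
  · obtain ⟨k, rfl⟩ : ∃ k : ℕ, d = -k := ⟨d.natAbs, by omega⟩
    have := key k (by simpa using hd)
    simp only [abs_neg, Nat.abs_cast, Int.cast_natCast]
    rw [← this, Finset.sum_comm]
    refine Finset.sum_congr rfl fun a _ => Finset.sum_congr rfl fun b _ => if_congr ?_ rfl rfl
    omega

theorem sum_zpow_diff {m n : ℕ} {h : Fin m → Fin m → ℂ} {T : ℤ → ℂ}
    (hT : ∀ d, ∑ a : Fin m, ∑ b : Fin m, (if ((b : ℕ) : ℤ) - (a : ℕ) = d then h a b else 0) = T d)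
    (hn : ∀ d, d ∉ Icc (-(n : ℤ)) n → T d = 0) (w : ℂ) :
    ∑ a : Fin m, ∑ b : Fin m, w ^ (((b : ℕ) : ℤ) - (a : ℕ)) * h a b =
      ∑ d ∈ Icc (-(n : ℤ)) n, T d * w ^ d := by
  have hsub : Icc (-(n : ℤ)) n ⊆ Icc (-((n + m : ℕ) : ℤ)) ((n + m : ℕ) : ℤ) :=
    Finset.Icc_subset_Icc (by omega) (by omega)
  rw [Finset.sum_subset hsub fun d _ hd => by rw [hn d hd, zero_mul]]
  simp only [← hT, Finset.sum_mul]
  conv_rhs => rw [Finset.sum_comm]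
  refine Finset.sum_congr rfl fun a _ => ?_
  conv_rhs => rw [Finset.sum_comm]
  refine Finset.sum_congr rfl fun b _ => ?_
  rw [Finset.sum_eq_single_of_mem (((b : ℕ) : ℤ) - (a : ℕ))]
  · rw [if_pos rfl, mul_comm]
  · have := a.2; have := b.2
    rw [mem_Icc]; constructor <;> omega
  · intro d _ hd
    rw [if_neg (Ne.symm hd), zero_mul]

theorem trigPoly_im_eq_zero {n m : ℕ} {e : ℤ → ℤ → ℂ} (he : ∀ k l, e (-k) (-l) = star (e k l))
    {z w : ℂ} (hz : ‖z‖ = 1) (hw : ‖w‖ = 1) : (trigPoly n m e z w).im = 0 := by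
  rw [← Complex.conj_eq_iff_im]
  have hneg : ∀ (n : ℕ) (g : ℤ → ℂ),
      ∑ k ∈ Icc (-(n : ℤ)) n, g k = ∑ k ∈ Icc (-(n : ℤ)) n, g (-k) := fun n g =>
    Finset.sum_nbij' (fun k => -k) (fun k => -k) (by simp only [mem_Icc]; omega)
      (by simp only [mem_Icc]; omega) (by simp) (by simp) (by simp)
  conv_rhs => rw [trigPoly, hneg n]
  simp only [trigPoly, map_sum]
  refine Finset.sum_congr rfl fun k _ => ?_
  rw [hneg m (fun l => e (-k) l * _)]
  refine Finset.sum_congr rfl fun l _ => ?_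
  rw [he, map_mul, map_mul, map_zpow₀, map_zpow₀, ← Complex.inv_eq_conj hz,
    ← Complex.inv_eq_conj hw, inv_zpow', inv_zpow']
  rfl

theorem trigPoly_sub {n m : ℕ} (e e' : ℤ → ℤ → ℂ) (z w : ℂ) :
    trigPoly n m (fun k l => e k l - e' k l) z w = trigPoly n m e z w - trigPoly n m e' z w := by
  simp only [trigPoly, sub_mul, Finset.sum_sub_distrib]

theorem norm_trigPoly_le {n m : ℕ} (e : ℤ → ℤ → ℂ) {z w : ℂ} (hz : ‖z‖ = 1) (hw : ‖w‖ = 1) :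
    ‖trigPoly n m e z w‖ ≤ ∑ k ∈ Icc (-(n : ℤ)) n, ∑ l ∈ Icc (-(m : ℤ)) m, ‖e k l‖ := by
  refine (norm_sum_le _ _).trans (Finset.sum_le_sum fun k _ => (norm_sum_le _ _).trans
    (Finset.sum_le_sum fun l _ => ?_))
  simp [hz, hw]

theorem trigPoly_single {n m : ℕ} (c : ℂ) (z w : ℂ) :
    trigPoly n m (fun k l => if k = 0 ∧ l = 0 then c else 0) z w = c := by
  rw [trigPoly, Finset.sum_eq_single_of_mem 0 (by simp), Finset.sum_eq_single_of_mem 0 (by simp)]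
  · simp
  · intro l _ hl; simp [hl]
  · intro k _ hk; simp [hk]

/-- Inverse Fejér weights perturb a trigonometric polynomial arbitrarily little. -/
theorem exists_weight_close {n m : ℕ} (t : ℤ → ℤ → ℂ) {η : ℝ} (hη : 0 < η) :
    ∃ M : ℕ, m ≤ M ∧ ∀ z w : ℂ, ‖z‖ = 1 → ‖w‖ = 1 →
      ‖trigPoly n m (fun k l => t k l * ((((M : ℝ) + 1) / ((M : ℝ) + 1 - |(l : ℝ)|) : ℝ) : ℂ)) z w -
        trigPoly n m t z w‖ ≤ η := by
  set S := ∑ k ∈ Icc (-(n : ℤ)) n, ∑ l ∈ Icc (-(m : ℤ)) m, ‖t k l‖ with hS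
  have hS0 : 0 ≤ S := Finset.sum_nonneg fun k _ => Finset.sum_nonneg fun l _ => norm_nonneg _
  obtain ⟨K, hK⟩ := exists_nat_ge (S * m / η)
  refine ⟨m + K, Nat.le_add_right _ _, fun z w hz hw => ?_⟩
  rw [← trigPoly_sub]
  refine (norm_trigPoly_le _ hz hw).trans ?_
  have hK1 : (0 : ℝ) < K + 1 := by positivity
  calc _ ≤ ∑ k ∈ Icc (-(n : ℤ)) n, ∑ l ∈ Icc (-(m : ℤ)) m, ‖t k l‖ * (m / (K + 1)) := by
        refine Finset.sum_le_sum fun k _ => Finset.sum_le_sum fun l hl => ?_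
        have hl' : |(l : ℝ)| ≤ m := by
          rw [mem_Icc] at hl
          rw [abs_le]
          exact ⟨by exact_mod_cast hl.1, by exact_mod_cast hl.2⟩
        rw [← mul_sub_one, norm_mul]
        refine mul_le_mul_of_nonneg_left ?_ (norm_nonneg _)
        rw [← Complex.ofReal_one, ← Complex.ofReal_sub, Complex.norm_real]
        push_cast
        have hp : (K : ℝ) + 1 ≤ m + K + 1 - |(l : ℝ)| := by linarith
        have hp' := hK1.trans_le hp
        rw [div_sub_one hp'.ne', Real.norm_eq_abs, abs_div, abs_of_pos hp',
          show (m : ℝ) + K + 1 - (m + K + 1 - |(l : ℝ)|) = |(l : ℝ)| by ring, abs_abs]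
        exact div_le_div₀ (Nat.cast_nonneg _) hl' hK1 hp
    _ = S * m / (K + 1) := by
        simp only [← Finset.sum_mul]; rw [mul_div_assoc]
    _ ≤ η := by
        rw [div_le_iff₀ hη] at hK
        rw [div_le_iff₀ hK1]
        nlinarith

theorem exists_toeplitz_factor {n m N : ℕ} {t : ℤ → ℤ → ℂ}
    (ht : ∀ k l, ¬(k ∈ Icc (-(n : ℤ)) n ∧ l ∈ Icc (-(m : ℤ)) m) → t k l = 0)
    (hsym : ∀ k l, t (-k) (-l) = star (t k l)) {η : ℝ} (hη : 0 < η)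
    (hre : ∀ z w : ℂ, ‖z‖ = 1 → ‖w‖ = 1 → η ≤ (trigPoly n m t z w).re) :
    ∃ (M : ℕ) (F : Matrix (Fin N) (Fin (M + 1) × Fin N) ℂ),
      (∀ d, blockDiagSum (Fᴴ * F) d =
        Matrix.of fun i j : Fin N => t ((j : ℕ) - (i : ℕ)) d) ∧
      ∀ a : Fin (M + 1), m < (a : ℕ) → ∀ k i, F k (a, i) = 0 := by
  obtain ⟨M, hmM, hM⟩ := exists_weight_close (n := n) (m := m) t (half_pos hη)
  refine ⟨M, ?_⟩
  let q : ℤ → ℤ → ℂ := fun k l => t k l * ((((M : ℝ) + 1) / ((M : ℝ) + 1 - |(l : ℝ)|) : ℝ) : ℂ) -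
    if k = 0 ∧ l = 0 then ((η / 2 : ℝ) : ℂ) else 0
  let e : ℤ → ℤ → ℂ := fun k l => ((((M : ℝ) + 1)⁻¹ : ℝ) : ℂ) * q k l
  have hq0 : ∀ k l, ¬(k ∈ Icc (-(n : ℤ)) n ∧ l ∈ Icc (-(m : ℤ)) m) → q k l = 0 := by
    intro k l h
    simp only [q]
    rw [ht k l h, zero_mul, if_neg, sub_zero]
    rintro ⟨rfl, rfl⟩
    exact h ⟨by simp, by simp⟩
  have hqsym : ∀ k l, q (-k) (-l) = star (q k l) := by
    intro k l
    simp only [q]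
    rw [hsym, star_sub, star_mul']
    simp only [Int.cast_neg, abs_neg, neg_eq_zero, Complex.star_def, Complex.conj_ofReal]
    split_ifs
    · rw [Complex.conj_ofReal]
    · rw [map_zero]
  have he0 : ∀ k l, ¬(k ∈ Icc (-(n : ℤ)) n ∧ l ∈ Icc (-(m : ℤ)) m) → e k l = 0 :=
    fun k l h => by simp only [e]; rw [hq0 k l h, mul_zero]
  have hpos : ∀ z w : ℂ, ‖z‖ = 1 → ‖w‖ = 1 → 0 ≤ trigPoly n m e z w := by
    intro z w hz hw
    have h1 : trigPoly n m e z w = ((((M : ℝ) + 1)⁻¹ : ℝ) : ℂ) * trigPoly n m q z w := by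
      simp only [trigPoly, e, Finset.mul_sum, mul_assoc]
    rw [h1]
    refine mul_nonneg (by exact_mod_cast (by positivity : (0 : ℝ) ≤ ((M : ℝ) + 1)⁻¹)) ?_
    rw [Complex.nonneg_iff]
    refine ⟨?_, (trigPoly_im_eq_zero hqsym hz hw).symm⟩
    simp only [q]
    rw [trigPoly_sub, trigPoly_single, Complex.sub_re, Complex.ofReal_re]
    have h2 := (Complex.abs_re_le_norm _).trans (hM z w hz hw)
    rw [Complex.sub_re] at h2
    have h3 := (abs_le.1 h2).1
    have h4 := hre z w hz hw
    linarith
  have hη2 : (0 : ℂ) ≤ ((η / 2 : ℝ) : ℂ) := by exact_mod_cast (half_pos hη).le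
  have hPSD := toeplitz_posSemidef (A := M + 1) (B := N) he0 hpos
  let E : Fin (M + 1) × Fin N → ℂ := fun x => if x.1 = 0 then ((η / 2 : ℝ) : ℂ) else 0
  have hE : (Matrix.diagonal E).PosSemidef := Matrix.PosSemidef.diagonal fun x => by
    simp only [E]
    split_ifs
    · exact hη2
    · exact le_rfl
  refine exists_factor_of_gram _ m ?_ (half_pos hη) _ (hPSD.add hE) ?_ ?_
  · intro d hd
    ext i j
    simp only [Matrix.of_apply, Matrix.zero_apply]
    refine ht _ _ fun h => ?_
    have := (mem_Icc.1 h.2).2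
    omega
  · convert hPSD.submatrix (Prod.mk (0 : Fin (M + 1))) using 1
    ext i j
    by_cases hij : i = j
    · simp [hij, E]
    · simp [hij, E]
  · intro d
    rw [blockDiagSum_add]
    ext i j
    have h1 : blockDiagSum (Matrix.diagonal E) d i j =
        if ((j : ℕ) : ℤ) - (i : ℕ) = 0 ∧ d = 0 then ((η / 2 : ℝ) : ℂ) else 0 := by
      simp only [blockDiagSum, Matrix.of_apply, E]
      rw [Finset.sum_eq_single 0, Finset.sum_eq_single 0]
      · simp only [Matrix.diagonal_apply, Prod.mk.injEq, true_and, if_true, sub_self]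
        by_cases hij : i = j
        · simp [hij, eq_comm]
        · have : ¬ ((j : ℕ) : ℤ) - (i : ℕ) = 0 := fun h => hij (Fin.ext (by omega))
          simp [hij, this]
      · intro b _ hb
        simp [Ne.symm hb]
      · simp
      · intro a _ ha
        refine Finset.sum_eq_zero fun b _ => ?_
        simp [Matrix.diagonal_apply, ha]
      · simp
    rw [Matrix.add_apply, h1]
    simp only [blockDiagSum, Matrix.of_apply]
    have h2 : ∀ a b : Fin (M + 1), (if ((b : ℕ) : ℤ) - (a : ℕ) = d then
        e ((j : ℕ) - (i : ℕ)) ((b : ℕ) - (a : ℕ)) else 0) =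
        if ((b : ℕ) : ℤ) - (a : ℕ) = d then e ((j : ℕ) - (i : ℕ)) d else 0 := fun a b => by
      split_ifs with h
      · rw [h]
      · rfl
    simp only [h2]
    by_cases hd : |d| ≤ (M + 1 : ℕ)
    · rw [sum_diff_eq hd]
      by_cases hdm : d ∈ Icc (-(m : ℤ)) m
      · have hd1 : |(d : ℝ)| ≤ m := by
          rw [mem_Icc] at hdm
          rw [abs_le]
          exact ⟨by exact_mod_cast hdm.1, by exact_mod_cast hdm.2⟩
        have hmM' : (m : ℝ) ≤ M := by exact_mod_cast hmM
        have hne : (M : ℝ) + 1 - |(d : ℝ)| ≠ 0 := by linarith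
        have hne2 : (M : ℝ) + 1 ≠ 0 := by positivity
        have hcast : (((M + 1 : ℕ) : ℂ) - ((|d| : ℤ) : ℂ)) =
            (((M : ℝ) + 1 - |(d : ℝ)| : ℝ) : ℂ) := by
          rw [← Int.cast_abs, Complex.ofReal_sub, Complex.ofReal_intCast]
          push_cast
          rfl
        rw [hcast]
        simp only [e, q]
        have h3 : (((M : ℝ) + 1 - |(d : ℝ)| : ℝ) : ℂ) * ((((M : ℝ) + 1)⁻¹ : ℝ) : ℂ) *
            ((((M : ℝ) + 1) / ((M : ℝ) + 1 - |(d : ℝ)|) : ℝ) : ℂ) = 1 := by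
          rw [← Complex.ofReal_mul, ← Complex.ofReal_mul, ← Complex.ofReal_one]
          congr 1
          field_simp
        by_cases h0 : ((j : ℕ) : ℤ) - (i : ℕ) = 0 ∧ d = 0
        · rw [if_pos h0]
          have h4 : (((M : ℝ) + 1 - |(d : ℝ)| : ℝ) : ℂ) * ((((M : ℝ) + 1)⁻¹ : ℝ) : ℂ) = 1 := by
            rw [← Complex.ofReal_mul, ← Complex.ofReal_one, h0.2]
            congr 1
            simp [hne2]
          linear_combination (t (((j : ℕ) : ℤ) - (i : ℕ)) d) * h3 - ((η / 2 : ℝ) : ℂ) * h4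
        · rw [if_neg h0]
          linear_combination (t (((j : ℕ) : ℤ) - (i : ℕ)) d) * h3
      · have h0 : ¬ (((j : ℕ) : ℤ) - (i : ℕ) = 0 ∧ d = 0) := by
          rintro ⟨-, rfl⟩
          simp at hdm
        rw [he0 _ _ fun h => hdm h.2, ht _ _ fun h => hdm h.2, if_neg h0]
        simp
    · have hdm : d ∉ Icc (-(m : ℤ)) m := by
        rw [mem_Icc, ← abs_le]; push_cast at hd; omega
      have h0 : ¬ (((j : ℕ) : ℤ) - (i : ℕ) = 0 ∧ d = 0) := by
        rintro ⟨-, rfl⟩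
        simp at hdm
      rw [he0 _ _ fun h => hdm h.2, ht _ _ fun h => hdm h.2, if_neg h0]
      simp

theorem eval_polynomial_of_row {M N : ℕ} (f : Fin (M + 1) × Fin N → ℂ) (z w : ℂ) :
    MvPolynomial.eval (fun i : Fin 2 => if i = 0 then z else w)
      (∑ x, MvPolynomial.C (f x) * (MvPolynomial.X 0 ^ (x.2 : ℕ) * MvPolynomial.X 1 ^ (x.1 : ℕ))) =
      ∑ x, f x * (z ^ (x.2 : ℕ) * w ^ (x.1 : ℕ)) := by
  simp [map_sum]

theorem sum_normSq_eq {κ ι : Type*} [Fintype κ] [Fintype ι] (F : Matrix ι κ ℂ) (u : κ → ℂ) :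
    ∑ k, (Complex.normSq (∑ x, F k x * u x) : ℂ) =
      ∑ x, ∑ y, (starRingEnd ℂ (u x) * u y) * (Fᴴ * F) x y := by
  simp only [← Complex.mul_conj, map_sum, map_mul, Matrix.mul_apply, Matrix.conjTranspose_apply,
    Finset.mul_sum, Finset.sum_mul]
  rw [Finset.sum_comm]
  conv_rhs =>
    enter [2, x]
    rw [Finset.sum_comm]
  conv_rhs => rw [Finset.sum_comm]
  conv_lhs => rw [Finset.sum_comm]
  refine Finset.sum_congr rfl fun k _ => ?_
  refine Finset.sum_congr rfl fun x _ => Finset.sum_congr rfl fun y _ => ?_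
  simp only [Complex.star_def]
  ring

theorem degreeOf_polynomial_of_row {M N n m : ℕ} (f : Fin (M + 1) × Fin N → ℂ) (hN : N ≤ n + 1)
    (hf : ∀ a : Fin (M + 1), m < (a : ℕ) → ∀ i, f (a, i) = 0) :
    (∑ x, MvPolynomial.C (f x) * (MvPolynomial.X (0 : Fin 2) ^ (x.2 : ℕ) *
      MvPolynomial.X 1 ^ (x.1 : ℕ)) : MvPolynomial (Fin 2) ℂ).degreeOf 0 ≤ n ∧
    (∑ x, MvPolynomial.C (f x) * (MvPolynomial.X (0 : Fin 2) ^ (x.2 : ℕ) *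
      MvPolynomial.X 1 ^ (x.1 : ℕ)) : MvPolynomial (Fin 2) ℂ).degreeOf 1 ≤ m := by
  have h0 : ∀ (i j : Fin 2) (a : ℕ), MvPolynomial.degreeOf i
      ((MvPolynomial.X j : MvPolynomial (Fin 2) ℂ) ^ a) ≤ if i = j then a else 0 := fun i j a => by
    refine (MvPolynomial.degreeOf_pow_le _ _ _).trans ?_
    rw [MvPolynomial.degreeOf_X]
    split_ifs <;> simp
  constructor
  · refine (MvPolynomial.degreeOf_sum_le _ _ _).trans (Finset.sup_le fun x _ => ?_)
    refine (MvPolynomial.degreeOf_C_mul_le _ _ _).trans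
      ((MvPolynomial.degreeOf_mul_le _ _ _).trans ((add_le_add (h0 _ _ _) (h0 _ _ _)).trans ?_))
    have := x.2.2
    simp; omega
  · refine (MvPolynomial.degreeOf_sum_le _ _ _).trans (Finset.sup_le fun x _ => ?_)
    by_cases hx : m < (x.1 : ℕ)
    · rw [hf x.1 hx x.2]; simp
    refine (MvPolynomial.degreeOf_C_mul_le _ _ _).trans
      ((MvPolynomial.degreeOf_mul_le _ _ _).trans ((add_le_add (h0 _ _ _) (h0 _ _ _)).trans ?_))
    simp; omega

theorem sum_gram_eq_trigPoly {M N n m : ℕ} {t : ℤ → ℤ → ℂ}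
    (ht : ∀ k l, ¬(k ∈ Icc (-(n : ℤ)) n ∧ l ∈ Icc (-(m : ℤ)) m) → t k l = 0) (hN : n ≤ N)
    (G : Matrix (Fin (M + 1) × Fin N) (Fin (M + 1) × Fin N) ℂ)
    (hG : ∀ d, blockDiagSum G d = Matrix.of fun i j : Fin N => t ((j : ℕ) - (i : ℕ)) d)
    {z w : ℂ} (hz : ‖z‖ = 1) (hw : ‖w‖ = 1) :
    ∑ x, ∑ y, (starRingEnd ℂ (z ^ (x.2 : ℕ) * w ^ (x.1 : ℕ)) * (z ^ (y.2 : ℕ) * w ^ (y.1 : ℕ))) *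
      G x y = trigPoly n m (fun k l => ((N : ℂ) - (|k| : ℤ)) * t k l) z w := by
  have hu : ∀ {z : ℂ}, ‖z‖ = 1 → ∀ a b : ℕ, starRingEnd ℂ (z ^ a) * z ^ b = z ^ ((b : ℤ) - a) := by
    intro z hz a b
    have h0 : z ≠ 0 := norm_ne_zero_iff.1 (by rw [hz]; exact one_ne_zero)
    rw [map_pow, ← Complex.inv_eq_conj hz, zpow_sub₀ h0, zpow_natCast, zpow_natCast, inv_pow]
    field_simp
  have h1 : ∀ x y : Fin (M + 1) × Fin N,
      (starRingEnd ℂ (z ^ (x.2 : ℕ) * w ^ (x.1 : ℕ)) * (z ^ (y.2 : ℕ) * w ^ (y.1 : ℕ))) * G x y =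
      z ^ (((y.2 : ℕ) : ℤ) - (x.2 : ℕ)) * (w ^ (((y.1 : ℕ) : ℤ) - (x.1 : ℕ)) * G x y) := by
    intro x y
    rw [← hu hz, ← hu hw, map_mul]
    ring
  simp only [h1, Fintype.sum_prod_type]
  have h2 : ∀ i j : Fin N, ∑ a : Fin (M + 1), ∑ b : Fin (M + 1),
      w ^ (((b : ℕ) : ℤ) - (a : ℕ)) * G (a, i) (b, j) =
      ∑ l ∈ Icc (-(m : ℤ)) m, t ((j : ℕ) - (i : ℕ)) l * w ^ l := fun i j =>
    sum_zpow_diff (fun d => congrFun (congrFun (hG d) i) j)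
      (fun d hd => ht _ _ fun h => hd h.2) w
  have h3 : ∑ a : Fin (M + 1), ∑ i : Fin N, ∑ b : Fin (M + 1), ∑ j : Fin N,
      z ^ (((j : ℕ) : ℤ) - (i : ℕ)) * (w ^ (((b : ℕ) : ℤ) - (a : ℕ)) * G (a, i) (b, j)) =
      ∑ i : Fin N, ∑ j : Fin N, z ^ (((j : ℕ) : ℤ) - (i : ℕ)) *
        ∑ l ∈ Icc (-(m : ℤ)) m, t ((j : ℕ) - (i : ℕ)) l * w ^ l := by
    rw [Finset.sum_comm]
    refine Finset.sum_congr rfl fun i _ => ?_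
    simp only [← h2, Finset.mul_sum]
    conv_rhs => rw [Finset.sum_comm]
    refine Finset.sum_congr rfl fun a _ => ?_
    rw [Finset.sum_comm]
  rw [h3, sum_zpow_diff (n := n) (T := fun k => ((N : ℂ) - (|k| : ℤ)) *
    ∑ l ∈ Icc (-(m : ℤ)) m, t k l * w ^ l)]
  · simp only [trigPoly, Finset.mul_sum, Finset.sum_mul]
    refine Finset.sum_congr rfl fun k _ => Finset.sum_congr rfl fun l _ => ?_
    ring
  · intro d
    have h4 : ∀ a b : Fin N, (if ((b : ℕ) : ℤ) - (a : ℕ) = d then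
        ∑ l ∈ Icc (-(m : ℤ)) m, t ((b : ℕ) - (a : ℕ)) l * w ^ l else 0) =
        if ((b : ℕ) : ℤ) - (a : ℕ) = d then ∑ l ∈ Icc (-(m : ℤ)) m, t d l * w ^ l else 0 :=
      fun a b => by
        split_ifs with h
        · rw [h]
        · rfl
    simp only [h4]
    by_cases hd : |d| ≤ N
    · exact sum_diff_eq hd _
    · have h5 : ∑ l ∈ Icc (-(m : ℤ)) m, t d l * w ^ l = 0 := by
        refine Finset.sum_eq_zero fun l _ => ?_
        rw [ht _ _, zero_mul]
        rw [mem_Icc, ← abs_le]; omega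
      simp [h5]
  · intro d hd
    rw [Finset.sum_eq_zero, mul_zero]
    intro l _
    rw [ht _ _ fun h => hd h.1, zero_mul]

theorem exists_sum_squares_of_symmetric {n₁ n₂ m₁ : ℕ} (hm₁ : n₁ < m₁) {c : ℤ → ℤ → ℂ}
    (hc : ∀ k l, ¬(k ∈ Icc (-(n₁ : ℤ)) n₁ ∧ l ∈ Icc (-(n₂ : ℤ)) n₂) → c k l = 0)
    (hsym : ∀ k l, c (-k) (-l) = star (c k l)) {ε C₁ : ℝ}
    (hre : ∀ z w : ℂ, ‖z‖ = 1 → ‖w‖ = 1 → ε ≤ (trigPoly n₁ n₂ c z w).re)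
    (hC₁ : ∀ k ∈ Icc (-(n₁ : ℤ)) n₁, ∀ w : ℂ, ‖w‖ = 1 →
      ‖∑ l ∈ Icc (-(n₂ : ℤ)) n₂, c k l * w ^ l‖ ≤ C₁)
    (hgap : (n₁ : ℝ) * (n₁ + 1) * C₁ / ((m₁ : ℝ) - n₁) < ε) :
    ∃ Q : Fin (m₁ + 1) → MvPolynomial (Fin 2) ℂ,
      (∀ k, (Q k).degreeOf 0 ≤ m₁ ∧ (Q k).degreeOf 1 ≤ n₂) ∧
      ∀ z w : ℂ, ‖z‖ = 1 → ‖w‖ = 1 → trigPoly n₁ n₂ c z w = ∑ k,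
        (Complex.normSq (MvPolynomial.eval (fun i : Fin 2 => if i = 0 then z else w) (Q k)) : ℂ) := by
  have hC0 : 0 ≤ C₁ := (norm_nonneg _).trans (hC₁ 0 (by simp) 1 (by simp))
  have hgap0 : (0 : ℝ) < (m₁ : ℝ) - n₁ := sub_pos.2 (by exact_mod_cast hm₁)
  let r : ℤ → ℝ := fun k => ((m₁ : ℝ) + 1 - |(k : ℝ)|)⁻¹
  have habs : ∀ k ∈ Icc (-(n₁ : ℤ)) n₁, |(k : ℝ)| ≤ n₁ := fun k hk => by
    rw [mem_Icc] at hk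
    rw [abs_le]
    exact ⟨by exact_mod_cast hk.1, by exact_mod_cast hk.2⟩
  let t : ℤ → ℤ → ℂ := fun k l => (r k : ℂ) * c k l
  have ht0 : ∀ k l, ¬(k ∈ Icc (-(n₁ : ℤ)) n₁ ∧ l ∈ Icc (-(n₂ : ℤ)) n₂) → t k l = 0 :=
    fun k l h => by simp only [t]; rw [hc k l h, mul_zero]
  have htsym : ∀ k l, t (-k) (-l) = star (t k l) := fun k l => by
    simp only [t, r]
    rw [hsym, star_mul', Int.cast_neg, abs_neg, Complex.star_def, Complex.conj_ofReal]
  set η := ε - (n₁ : ℝ) * (n₁ + 1) * C₁ / ((m₁ : ℝ) - n₁) with hη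
  have hη0 : 0 < η := sub_pos.2 hgap
  have hN : (0 : ℝ) < (m₁ : ℝ) + 1 := by positivity
  have htre : ∀ z w : ℂ, ‖z‖ = 1 → ‖w‖ = 1 → η / ((m₁ : ℝ) + 1) ≤ (trigPoly n₁ n₂ t z w).re := by
    intro z w hz hw
    have h1 : ((((m₁ : ℝ) + 1) : ℝ) : ℂ) * trigPoly n₁ n₂ t z w - trigPoly n₁ n₂ c z w =
        ∑ k ∈ Icc (-(n₁ : ℤ)) n₁, (((((m₁ : ℝ) + 1) * r k - 1 : ℝ) : ℂ) * z ^ k) *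
          ∑ l ∈ Icc (-(n₂ : ℤ)) n₂, c k l * w ^ l := by
      simp only [trigPoly, Finset.mul_sum, ← Finset.sum_sub_distrib, t]
      refine Finset.sum_congr rfl fun k _ => Finset.sum_congr rfl fun l _ => ?_
      push_cast
      ring
    have h2 : ‖((((m₁ : ℝ) + 1) : ℝ) : ℂ) * trigPoly n₁ n₂ t z w - trigPoly n₁ n₂ c z w‖ ≤
        (n₁ : ℝ) * (n₁ + 1) * C₁ / ((m₁ : ℝ) - n₁) := by
      rw [h1]
      calc _ ≤ ∑ k ∈ Icc (-(n₁ : ℤ)) n₁, |(k : ℝ)| * (C₁ / ((m₁ : ℝ) - n₁)) := by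
            refine (norm_sum_le _ _).trans (Finset.sum_le_sum fun k hk => ?_)
            have hp : (m₁ : ℝ) - n₁ ≤ (m₁ : ℝ) + 1 - |(k : ℝ)| := by linarith [habs k hk]
            have hp' := hgap0.trans_le hp
            have h3 : ((m₁ : ℝ) + 1) * r k - 1 = |(k : ℝ)| / ((m₁ : ℝ) + 1 - |(k : ℝ)|) := by
              simp only [r]
              field_simp
              ring
            rw [norm_mul, norm_mul, norm_zpow, hz, one_zpow, mul_one, Complex.norm_real, h3,
              Real.norm_eq_abs, abs_div, abs_abs, abs_of_pos hp', mul_div_assoc', mul_comm,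
              mul_div_assoc', mul_comm]
            exact div_le_div₀ (by positivity)
              (mul_le_mul_of_nonneg_left (hC₁ k hk w hw) (abs_nonneg _)) hgap0 hp
        _ = _ := by
            rw [← Finset.sum_mul, sum_Icc_abs, mul_div_assoc]
    have h3 := (abs_le.1 ((Complex.abs_re_le_norm _).trans h2)).1
    rw [Complex.sub_re, Complex.re_ofReal_mul] at h3
    have h4 := hre z w hz hw
    rw [div_le_iff₀ hN]
    linarith
  obtain ⟨M, F, hF, hF0⟩ := exists_toeplitz_factor (N := m₁ + 1) ht0 htsym (div_pos hη0 hN) htre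
  refine ⟨fun k => ∑ x, MvPolynomial.C (F k x) *
    (MvPolynomial.X 0 ^ (x.2 : ℕ) * MvPolynomial.X 1 ^ (x.1 : ℕ)),
    fun k => degreeOf_polynomial_of_row (F k) le_rfl fun a ha i => hF0 a ha k i, ?_⟩
  intro z w hz hw
  simp only [eval_polynomial_of_row]
  rw [sum_normSq_eq, sum_gram_eq_trigPoly ht0 (by omega) _ hF hz hw]
  refine Finset.sum_congr rfl fun k hk => Finset.sum_congr rfl fun l _ => ?_
  congr 1
  have hp : (m₁ : ℝ) + 1 - |(k : ℝ)| ≠ 0 := by linarith [habs k hk]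
  have hcast : (((m₁ + 1 : ℕ) : ℂ) - ((|k| : ℤ) : ℂ)) =
      (((m₁ : ℝ) + 1 - |(k : ℝ)| : ℝ) : ℂ) := by
    rw [← Int.cast_abs, Complex.ofReal_sub, Complex.ofReal_intCast]
    push_cast
    rfl
  have h1 : (((m₁ : ℝ) + 1 - |(k : ℝ)| : ℝ) : ℂ) * (r k : ℂ) = 1 := by
    rw [← Complex.ofReal_mul, ← Complex.ofReal_one]
    congr 1
    exact mul_inv_cancel₀ hp
  beta_reduce
  rw [hcast]
  simp only [t]
  rw [← mul_assoc, h1, one_mul]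

end

/-- Theorem 2.1 of the paper: let `P(z₁,z₂) = ∑_{k=-n₁}^{n₁} p_k(z₂) z₁^k` (with each `p_k` a
Laurent polynomial in `z₂` of degree at most `n₂`) be real-valued with `P ≥ ε > 0` on the
bitorus, let `C₁` bound all `|p_k(z₂)|` on the circle, and let `m₁ > n₁` satisfy
`n₁(n₁+1)C₁/(m₁-n₁) < ε`.  Then `P` is a sum of at most `m₁ + 1` square magnitudes of
polynomials of degree ≤ `m₁` in `z₁` and ≤ `n₂` in `z₂`. -/
theorem stmt_1 (n₁ n₂ : ℕ) (c : ℤ → ℤ → ℂ)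
    (p : ℤ → ℂ → ℂ)
    (hp : ∀ (k : ℤ) (z₂ : ℂ), p k z₂ = ∑ j ∈ Finset.Icc (-(n₂ : ℤ)) n₂, c k j * z₂ ^ j)
    (P : ℂ → ℂ → ℂ)
    (hP : ∀ z₁ z₂ : ℂ, P z₁ z₂ = ∑ k ∈ Finset.Icc (-(n₁ : ℤ)) n₁, p k z₂ * z₁ ^ k)
    (ε : ℝ) (hε : 0 < ε)
    (hpos : ∀ z₁ z₂ : ℂ, ‖z₁‖ = 1 → ‖z₂‖ = 1 →
      (P z₁ z₂).im = 0 ∧ ε ≤ (P z₁ z₂).re)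
    (C₁ : ℝ)
    (hC₁ : ∀ k ∈ Finset.Icc (-(n₁ : ℤ)) n₁, ∀ z₂ : ℂ, ‖z₂‖ = 1 → ‖p k z₂‖ ≤ C₁)
    (m₁ : ℕ) (hm₁ : n₁ < m₁)
    (hgap : (n₁ : ℝ) * (n₁ + 1) * C₁ / ((m₁ : ℝ) - n₁) < ε) :
    ∃ (r : ℕ), r ≤ m₁ + 1 ∧
      ∃ Q : Fin r → MvPolynomial (Fin 2) ℂ,
        (∀ k : Fin r, (Q k).degreeOf 0 ≤ m₁ ∧ (Q k).degreeOf 1 ≤ n₂) ∧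
        ∀ z₁ z₂ : ℂ, ‖z₁‖ = 1 → ‖z₂‖ = 1 →
          P z₁ z₂ = ∑ k : Fin r,
            (Complex.normSq (MvPolynomial.eval (fun i : Fin 2 => if i = 0 then z₁ else z₂) (Q k)) : ℂ) := by
  let s : ℤ → ℤ → ℂ := fun k l =>
    if k ∈ Icc (-(n₁ : ℤ)) n₁ ∧ l ∈ Icc (-(n₂ : ℤ)) n₂ then
      (c k l + star (c (-k) (-l))) / 2 else 0
  have hneg : ∀ (n : ℕ) (g : ℤ → ℂ),
      ∑ k ∈ Icc (-(n : ℤ)) n, g k = ∑ k ∈ Icc (-(n : ℤ)) n, g (-k) := fun n g =>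
    Finset.sum_nbij' (fun k => -k) (fun k => -k) (by simp only [mem_Icc]; omega)
      (by simp only [mem_Icc]; omega) (by simp) (by simp) (by simp)
  have hs0 : ∀ k l, ¬(k ∈ Icc (-(n₁ : ℤ)) n₁ ∧ l ∈ Icc (-(n₂ : ℤ)) n₂) → s k l = 0 :=
    fun k l h => if_neg h
  have hssym : ∀ k l, s (-k) (-l) = star (s k l) := by
    intro k l
    have hiff : (-k ∈ Icc (-(n₁ : ℤ)) n₁ ∧ -l ∈ Icc (-(n₂ : ℤ)) n₂) ↔
        (k ∈ Icc (-(n₁ : ℤ)) n₁ ∧ l ∈ Icc (-(n₂ : ℤ)) n₂) := by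
      simp only [mem_Icc]; omega
    simp only [s, hiff]
    split_ifs
    · simp only [neg_neg, star_div₀, star_add, star_star, star_ofNat]
      ring
    · simp
  have hsp : ∀ k ∈ Icc (-(n₁ : ℤ)) n₁, ∀ w : ℂ, ‖w‖ = 1 →
      ∑ l ∈ Icc (-(n₂ : ℤ)) n₂, s k l * w ^ l = (p k w + star (p (-k) w)) / 2 := by
    intro k hk w hw
    rw [hp, hp, hneg n₂ (fun l => c (-k) l * w ^ l), star_sum, ← Finset.sum_add_distrib,
      Finset.sum_div]
    refine Finset.sum_congr rfl fun l hl => ?_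
    simp only [s]
    rw [if_pos ⟨hk, hl⟩, star_mul', star_zpow₀, Complex.star_def,
      ← Complex.inv_eq_conj hw, inv_zpow', neg_neg]
    ring
  have hPs : ∀ z w : ℂ, ‖z‖ = 1 → ‖w‖ = 1 → trigPoly n₁ n₂ s z w = P z w := by
    intro z w hz hw
    have h1 : trigPoly n₁ n₂ s z w = (P z w + star (P z w)) / 2 := by
      conv_rhs => rw [hP, star_sum, hneg n₁ (fun k => star (p k w * z ^ k)),
        ← Finset.sum_add_distrib, Finset.sum_div]
      refine Finset.sum_congr rfl fun k hk => ?_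
      rw [star_mul', star_zpow₀, Complex.star_def, ← Complex.inv_eq_conj hz,
        inv_zpow', neg_neg]
      have h2 := hsp k hk w hw
      rw [Complex.star_def] at h2
      rw [← add_mul, mul_div_right_comm, ← h2, Finset.sum_mul]
      refine Finset.sum_congr rfl fun l _ => ?_
      ring
    rw [h1, Complex.star_def, Complex.conj_eq_iff_im.2 (hpos z w hz hw).1]
    ring
  obtain ⟨Q, hQ, hQs⟩ := exists_sum_squares_of_symmetric hm₁ hs0 hssym
    (fun z w hz hw => by rw [hPs z w hz hw]; exact (hpos z w hz hw).2)
    (fun k hk w hw => by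
      rw [hsp k hk w hw, norm_div, Complex.norm_ofNat]
      have hk' : -k ∈ Icc (-(n₁ : ℤ)) n₁ := by
        rw [mem_Icc] at hk ⊢; omega
      have h1 := norm_add_le (p k w) (star (p (-k) w))
      rw [norm_star] at h1
      have := hC₁ k hk w hw
      have := hC₁ (-k) hk' w hw
      linarith) hgap
  exact ⟨m₁ + 1, le_rfl, Q, hQ, fun z w hz hw => by rw [← hPs z w hz hw, hQs z w hz hw]⟩
end

section
/- Let A be a bounded self-adjoint operator on ℓ²(ℤ, ℂ) that is positive, banded with bandwidth b (i.e., ⟨e_i, A e_k⟩ = 0 whenever |i−k| > b, where (e_i) is the standard orthonormal basis), and satisfies ‖A − I‖ < 1 in operator norm. Let Q be the unique positive square root of A. For each N, let A_N := Π_N A Π_N be the N-th central section of A, and let Q̂_N be the unique positive semidefinite operator with Q̂_N² = A_N and Q̂_N = Π_N Q̂_N Π_N. Then for every finitely supported δ ∈ ℓ²(ℤ, ℂ) there exist a constant K > 0 and λ ∈ (0,1) such that ‖(Q − Q̂_N)δ‖₂ ≤ K λ^N for all N. -/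
open scoped ComplexInnerProductSpace
open Filter

noncomputable abbrev l2Z : Type := lp (fun _ : ℤ => ℂ) 2

/-- the standard basis vector of `ℓ²(ℤ, ℂ)` -/
noncomputable def e (i : ℤ) : l2Z := lp.single 2 i 1

open Polynomial

theorem exists_polynomial_approx_sqrt {r : ℝ} (hr : 0 ≤ r) (hr1 : r < 1) :
    ∃ a ∈ Set.Ioo (0 : ℝ) 1, ∃ C > 0, ∀ n : ℕ, ∃ p : ℝ[X], p.natDegree ≤ n ∧
      ∀ x : ℝ, |x - 1| ≤ r → |√x - p.eval x| ≤ C * a ^ n := by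
  obtain ⟨s, hrs, hs1⟩ := exists_between hr1
  lift s to NNReal using hr.trans hrs.le
  obtain ⟨a, ha, C, hC, h⟩ :=
    (Real.one_add_rpow_hasFPowerSeriesOnBall_zero (a := 1 / 2)).uniform_geometric_approx
      (r' := s) (by exact_mod_cast hs1)
  refine ⟨a, ha, C, hC, fun n => ⟨∑ k ∈ Finset.range n,
    Polynomial.C ((binomialSeries ℝ (1 / 2 : ℝ)).coeff k) * (X - 1) ^ k, ?_, fun x hx => ?_⟩⟩
  · refine natDegree_sum_le_of_forall_le _ _ fun k hk => ?_
    refine (natDegree_C_mul_le _ _).trans ((natDegree_pow_le).trans ?_)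
    have : (X - 1 : ℝ[X]).natDegree = 1 := by simpa using natDegree_X_sub_C (1 : ℝ)
    rw [this, mul_one]
    exact (Finset.mem_range.mp hk).le
  · have h1 := h (x - 1) (by simpa using hx.trans_lt hrs) n
    simp only [zero_add, add_sub_cancel, ← Real.sqrt_eq_rpow, FormalMultilinearSeries.partialSum,
      FormalMultilinearSeries.apply_eq_pow_smul_coeff, Real.norm_eq_abs] at h1
    simpa [eval_finsetSum, mul_comm] using h1

theorem CStarAlgebra.norm_sub_aeval_le {R : Type*} [CStarAlgebra R] [PartialOrder R]
    [StarOrderedRing R] {q a : R} (hq : 0 ≤ q) (ha : q * q = a) {r c : ℝ} (hr : ‖a - 1‖ ≤ r)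
    (hc : 0 ≤ c) (p : ℝ[X]) (hp : ∀ x : ℝ, |x - 1| ≤ r → |√x - p.eval x| ≤ c) :
    ‖q - aeval a p‖ ≤ c := by
  rcases subsingleton_or_nontrivial R with _ | _
  · simpa [Subsingleton.elim (q - aeval a p) 0] using hc
  have hsa : IsSelfAdjoint a := by
    rw [← ha]; exact (IsSelfAdjoint.of_nonneg hq).commute_iff (IsSelfAdjoint.of_nonneg hq) |>.mp rfl
  have ha0 : 0 ≤ a := ha ▸ (IsSelfAdjoint.of_nonneg hq).mul_self_nonneg
  have hq' : q = cfc Real.sqrt a := by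
    rw [← cfcₙ_eq_cfc, ← CFC.sqrt_eq_real_sqrt a, CFC.sqrt_unique ha]
  rw [hq', ← cfc_polynomial p a, ← cfc_sub ..]
  refine norm_cfc_le hc fun x hx => hp x ?_
  have : x - 1 ∈ spectrum ℝ (a - 1) := by
    have := spectrum.sub_singleton_eq a (1 : ℝ)
    rw [map_one] at this
    rw [← this]
    exact Set.sub_mem_sub hx rfl
  exact (spectrum.norm_le_norm_of_mem this).trans hr

theorem inner_e_left (i : ℤ) (v : l2Z) : ⟪e i, v⟫ = v i := by
  simp [e, lp.inner_single_left]

theorem e_apply (i j : ℤ) : e i j = if j = i then 1 else 0 := by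
  simp [e, lp.single_apply, Pi.single_apply]

/-- The coordinates of `T v`, computed from the matrix of `T` in the standard basis. -/
theorem hasSum_matrix_mul_apply (T : l2Z →L[ℂ] l2Z) (v : l2Z) (i : ℤ) :
    HasSum (fun k => T (e k) i * v k) (T v i) := by
  have h := lp.hasSum_inner (𝕜 := ℂ) (T.adjoint (e i)) v
  rw [ContinuousLinearMap.adjoint_inner_left, inner_e_left] at h
  refine h.congr_fun fun k => ?_
  have hk : T.adjoint (e i) k = starRingEnd ℂ (T (e k) i) := by
    rw [← inner_e_left, ContinuousLinearMap.adjoint_inner_right, ← inner_conj_symm, inner_e_left]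
  rw [hk]
  simp [mul_comm]

theorem l2Z_clm_ext {S T : l2Z →L[ℂ] l2Z} (h : ∀ i j, S (e j) i = T (e j) i) : S = T := by
  ext v i
  have hS := hasSum_matrix_mul_apply S v i
  simp only [h] at hS
  exact hS.unique (hasSum_matrix_mul_apply T v i)

/-- `v` vanishes outside the box `[-M, M]`. -/
def SupportedInBox (M : ℕ) (v : l2Z) : Prop := ∀ i : ℤ, (M : ℤ) < |i| → v i = 0

theorem SupportedInBox.mono {M N : ℕ} {v : l2Z} (hv : SupportedInBox M v) (h : M ≤ N) :
    SupportedInBox N v := fun i hi => hv i (by omega)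

theorem exists_supportedInBox {v : l2Z} (hv : ∃ s : Finset ℤ, ∀ i ∉ s, v i = 0) :
    ∃ M, SupportedInBox M v := by
  obtain ⟨s, hs⟩ := hv
  refine ⟨s.sup Int.natAbs, fun i hi => hs i fun his => ?_⟩
  have := Finset.le_sup (f := Int.natAbs) his
  grind

theorem SupportedInBox.map_of_band {A : l2Z →L[ℂ] l2Z} {b : ℕ}
    (hband : ∀ i k : ℤ, |i - k| > (b : ℤ) → ⟪e i, A (e k)⟫ = 0) {M : ℕ} {v : l2Z}
    (hv : SupportedInBox M v) : SupportedInBox (M + b) (A v) := by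
  intro i hi
  refine (hasSum_matrix_mul_apply A v i).unique ?_
  convert! hasSum_zero with k
  by_cases hk : (M : ℤ) < |k|
  · rw [hv k hk, mul_zero]
  · rw [← inner_e_left, hband i k (by grind), zero_mul]

theorem SupportedInBox.pow_of_band {A : l2Z →L[ℂ] l2Z} {b : ℕ}
    (hband : ∀ i k : ℤ, |i - k| > (b : ℤ) → ⟪e i, A (e k)⟫ = 0) {M : ℕ} {v : l2Z}
    (hv : SupportedInBox M v) (n : ℕ) : SupportedInBox (M + n * b) ((A ^ n) v) := by
  induction n with
  | zero => simpa using hv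
  | succ n ih =>
    rw [pow_succ', add_one_mul, ← add_assoc]
    exact ih.map_of_band hband

/-- The orthogonal projection onto the coordinates in the box `[-N, N]`. -/
noncomputable def boxProj (N : ℕ) : l2Z →L[ℂ] l2Z :=
  ∑ i ∈ Finset.Icc (-(N : ℤ)) N, InnerProductSpace.rankOne ℂ (e i) (e i)

theorem boxProj_apply (N : ℕ) (v : l2Z) (j : ℤ) :
    boxProj N v j = if |j| ≤ (N : ℤ) then v j else 0 := by
  rw [← inner_e_left, boxProj, sum_apply, inner_sum]
  simp [InnerProductSpace.rankOne_apply, inner_smul_right, inner_e_left, e_apply, abs_le]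

theorem boxProj_apply_of_supported {N : ℕ} {v : l2Z} (hv : SupportedInBox N v) :
    boxProj N v = v := by
  ext j
  rw [boxProj_apply]
  split_ifs with h
  · rfl
  · exact (hv j (not_le.mp h)).symm

theorem boxProj_e (N : ℕ) (j : ℤ) : boxProj N (e j) = if |j| ≤ (N : ℤ) then e j else 0 := by
  ext i
  rw [boxProj_apply, e_apply]
  by_cases hj : |j| ≤ (N : ℤ)
  · rw [if_pos hj, e_apply]
    grind
  · rw [if_neg hj, lp.coeFn_zero, Pi.zero_apply]
    grind

theorem isStarProjection_boxProj (N : ℕ) : IsStarProjection (boxProj N) where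
  isIdempotentElem := by
    ext v j
    simp only [mul_apply_eq_comp, boxProj_apply]
    split_ifs <;> rfl
  isSelfAdjoint := by
    rw [boxProj, isSelfAdjoint_iff, star_sum]
    simp [ContinuousLinearMap.star_eq_adjoint]

/-- The `N`-th central section of `A`, extended by the identity outside the box `[-N, N]`. -/
noncomputable def unitizedSection (A : l2Z →L[ℂ] l2Z) (N : ℕ) : l2Z →L[ℂ] l2Z :=
  boxProj N * A * boxProj N + (1 - boxProj N)

theorem norm_unitizedSection_sub_one_le (A : l2Z →L[ℂ] l2Z) (N : ℕ) :
    ‖unitizedSection A N - 1‖ ≤ ‖A - 1‖ := by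
  have hP := isStarProjection_boxProj N
  have h : unitizedSection A N - 1 = boxProj N * (A - 1) * boxProj N := by
    rw [mul_sub, sub_mul, mul_one, hP.isIdempotentElem.eq, unitizedSection]
    abel
  have hn := hP.norm_le
  calc ‖unitizedSection A N - 1‖ ≤ ‖boxProj N‖ * ‖A - 1‖ * ‖boxProj N‖ := by
        rw [h]
        exact norm_mul₃_le
    _ ≤ 1 * ‖A - 1‖ * 1 := by gcongr
    _ = ‖A - 1‖ := by ring

theorem unitizedSection_apply {A : l2Z →L[ℂ] l2Z} {N : ℕ} {v : l2Z} (hv : SupportedInBox N v)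
    (hAv : SupportedInBox N (A v)) : unitizedSection A N v = A v := by
  simp [unitizedSection, boxProj_apply_of_supported hv, boxProj_apply_of_supported hAv]

theorem unitizedSection_pow_apply {A : l2Z →L[ℂ] l2Z} {b : ℕ}
    (hband : ∀ i k : ℤ, |i - k| > (b : ℤ) → ⟪e i, A (e k)⟫ = 0) {M N : ℕ} {v : l2Z}
    (hv : SupportedInBox M v) {n : ℕ} (hn : M + n * b ≤ N) :
    (unitizedSection A N ^ n) v = (A ^ n) v := by
  induction n with
  | zero => rfl
  | succ n ih =>
    have hn' : M + n * b ≤ N := by grind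
    have h := hv.pow_of_band hband (n + 1)
    rw [pow_succ', mul_apply_eq_comp] at h
    rw [pow_succ', pow_succ', mul_apply_eq_comp, mul_apply_eq_comp, ih hn',
      unitizedSection_apply ((hv.pow_of_band hband n).mono hn') (h.mono hn)]

theorem aeval_unitizedSection_apply {A : l2Z →L[ℂ] l2Z} {b : ℕ}
    (hband : ∀ i k : ℤ, |i - k| > (b : ℤ) → ⟪e i, A (e k)⟫ = 0) {M N : ℕ} {v : l2Z}
    (hv : SupportedInBox M v) {p : ℝ[X]} (hp : M + p.natDegree * b ≤ N) :
    aeval (unitizedSection A N) p v = aeval A p v := by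
  rw [aeval_eq_sum_range, aeval_eq_sum_range, sum_apply,
    sum_apply]
  refine Finset.sum_congr rfl fun k hk => ?_
  have hk' : k ≤ p.natDegree := Finset.mem_range_succ_iff.mp hk
  have : M + k * b ≤ N := le_trans (by gcongr) hp
  rw [smul_apply, smul_apply,
    unitizedSection_pow_apply hband hv this]

/-- A square root of the central section of `A`, extended by the identity outside the box, is a
square root of `unitizedSection A N`. -/
theorem sq_add_one_sub_boxProj {A R : l2Z →L[ℂ] l2Z} {N : ℕ}
    (hsupp : ∀ i j : ℤ, (|i| > (N : ℤ) ∨ |j| > (N : ℤ)) → ⟪e i, R (e j)⟫ = 0)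
    (hsq : ∀ i j : ℤ, ⟪e i, (R ∘L R) (e j)⟫ =
      if |i| ≤ (N : ℤ) ∧ |j| ≤ (N : ℤ) then ⟪e i, A (e j)⟫ else 0) :
    (R + (1 - boxProj N)) * (R + (1 - boxProj N)) = unitizedSection A N := by
  simp only [inner_e_left] at hsupp hsq
  have hRP : R * boxProj N = R := l2Z_clm_ext fun i j => by
    rw [mul_apply_eq_comp, boxProj_e]
    split_ifs with h
    · rfl
    · rw [hsupp i j (.inr (not_le.mp h)), map_zero]
      rfl
  have hPR : boxProj N * R = R := l2Z_clm_ext fun i j => by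
    rw [mul_apply_eq_comp, boxProj_apply]
    split_ifs with h
    · rfl
    · rw [hsupp i j (.inl (not_le.mp h))]
  have hRR : R * R = boxProj N * A * boxProj N := l2Z_clm_ext fun i j => by
    rw [mul_apply_eq_comp (boxProj N * A), mul_apply_eq_comp (boxProj N),
      boxProj_apply, boxProj_e]
    refine (hsq i j).trans ?_
    by_cases hi : |i| ≤ (N : ℤ) <;> by_cases hj : |j| ≤ (N : ℤ) <;> simp [hi, hj]
  have hPP := (isStarProjection_boxProj N).isIdempotentElem.eq
  rw [unitizedSection, ← hRR]
  simp only [add_mul, mul_add, sub_mul, mul_sub, one_mul, mul_one, hRP, hPR, hPP]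
  abel

theorem exists_geometric_bound_of_eventually {f : ℕ → ℝ} {D lam : ℝ} {M : ℕ}
    (hlam : lam ∈ Set.Ioo (0 : ℝ) 1) (h : ∀ N, M ≤ N → f N ≤ D * lam ^ N) :
    ∃ K : ℝ, 0 < K ∧ ∀ N, f N ≤ K * lam ^ N := by
  have hpos := fun N : ℕ => pow_pos hlam.1 N
  have hS : 0 ≤ ∑ N ∈ Finset.range M, |f N| / lam ^ N :=
    Finset.sum_nonneg fun N _ => div_nonneg (abs_nonneg _) (hpos N).le
  refine ⟨|D| + ∑ N ∈ Finset.range M, |f N| / lam ^ N + 1, by positivity, fun N => ?_⟩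
  rcases le_or_gt M N with hN | hN
  · refine (h N hN).trans (mul_le_mul_of_nonneg_right ?_ (hpos N).le)
    linarith [le_abs_self D]
  · have := Finset.single_le_sum (f := fun N => |f N| / lam ^ N)
      (fun N _ => div_nonneg (abs_nonneg _) (hpos N).le) (Finset.mem_range.mpr hN)
    rw [← div_le_iff₀ (hpos N)]
    have h2 : f N / lam ^ N ≤ |f N| / lam ^ N := by
      gcongr
      exacts [(hpos N).le, le_abs_self _]
    linarith [abs_nonneg D]

/-- Theorem 3.2 of the paper: let `A` be a positive banded operator on `ℓ²(ℤ, ℂ)` with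
`‖A − I‖ < 1`, let `Q` be its unique positive square root, and for each `N` let `Q̂_N` be the
positive square root of the central section `A_N = Π_N A Π_N` (supported in the box `[-N,N]²`).
Then for every finitely supported `δ`, `‖(Q − Q̂_N) δ‖ ≤ K λ^N` for some `K > 0`, `λ ∈ (0,1)`. -/
theorem stmt_3 (b : ℕ) (hb : 0 < b)
    (A : l2Z →L[ℂ] l2Z) (hApos : A.IsPositive)
    (hband : ∀ i k : ℤ, |i - k| > (b : ℤ) → ⟪e i, A (e k)⟫ = 0)
    (hnorm : ‖A - 1‖ < 1)
    (Q : l2Z →L[ℂ] l2Z) (hQpos : Q.IsPositive) (hQ : Q ∘L Q = A)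
    (Qh : ℕ → (l2Z →L[ℂ] l2Z))
    (hQhpos : ∀ N, (Qh N).IsPositive)
    (hQhsupp : ∀ (N : ℕ) (i j : ℤ), (|i| > (N : ℤ) ∨ |j| > (N : ℤ)) →
      ⟪e i, Qh N (e j)⟫ = 0)
    (hQhsq : ∀ (N : ℕ) (i j : ℤ),
      ⟪e i, (Qh N ∘L Qh N) (e j)⟫ =
        if |i| ≤ (N : ℤ) ∧ |j| ≤ (N : ℤ) then ⟪e i, A (e j)⟫ else 0)
    (δ : l2Z) (hδ : ∃ s : Finset ℤ, ∀ i ∉ s, δ i = 0) :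
    ∃ K : ℝ, 0 < K ∧ ∃ lam ∈ Set.Ioo (0 : ℝ) 1,
      ∀ N : ℕ, ‖(Q - Qh N) δ‖ ≤ K * lam ^ N := by
  obtain ⟨M, hM⟩ := exists_supportedInBox hδ
  obtain ⟨a, ha, C, hC, happrox⟩ := exists_polynomial_approx_sqrt (norm_nonneg (A - 1)) hnorm
  have hb0 : (b : ℝ) ≠ 0 := by positivity
  obtain ⟨lam, hlam, hlama⟩ : ∃ lam ∈ Set.Ioo (0 : ℝ) 1, lam ^ b = a :=
    ⟨a ^ (b : ℝ)⁻¹, ⟨Real.rpow_pos_of_pos ha.1 _, Real.rpow_lt_one ha.1.le ha.2 (by positivity)⟩,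
      Real.rpow_inv_natCast_pow ha.1.le hb.ne'⟩
  suffices h : ∀ N, M ≤ N →
      ‖(Q - Qh N) δ‖ ≤ 2 * C * ‖δ‖ / lam ^ (M + b) * lam ^ N by
    obtain ⟨K, hK, hKN⟩ := exists_geometric_bound_of_eventually hlam h
    exact ⟨K, hK, lam, hlam, hKN⟩
  intro N hN
  set n := (N - M) / b with hn
  obtain ⟨p, hpdeg, hp⟩ := happrox n
  have hc : 0 ≤ C * a ^ n := by have := ha.1; positivity
  have hnb : n * b ≤ N - M := Nat.div_mul_le_self _ _
  have hnb' : N ≤ M + b + n * b := by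
    have := Nat.lt_div_mul_add (a := N - M) hb
    rw [← hn] at this
    omega
  have h1 : ‖Q - aeval A p‖ ≤ C * a ^ n :=
    CStarAlgebra.norm_sub_aeval_le ((ContinuousLinearMap.nonneg_iff_isPositive Q).mpr hQpos) hQ
      le_rfl hc p hp
  have h2 : ‖Qh N + (1 - boxProj N) - aeval (unitizedSection A N) p‖ ≤ C * a ^ n :=
    CStarAlgebra.norm_sub_aeval_le
      (add_nonneg ((ContinuousLinearMap.nonneg_iff_isPositive _).mpr (hQhpos N))
        (isStarProjection_boxProj N).one_sub.nonneg)
      (sq_add_one_sub_boxProj (hQhsupp N) (hQhsq N))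
      (norm_unitizedSection_sub_one_le A N) hc p hp
  have hdeg : M + p.natDegree * b ≤ N := by
    have : p.natDegree * b ≤ n * b := by gcongr
    omega
  have key : (Q - Qh N) δ = (Q - aeval A p) δ -
      (Qh N + (1 - boxProj N) - aeval (unitizedSection A N) p) δ := by
    simp [aeval_unitizedSection_apply hband hM hdeg, boxProj_apply_of_supported (hM.mono hN)]
  have hpow : a ^ n ≤ lam ^ N / lam ^ (M + b) := by
    rw [le_div_iff₀ (pow_pos hlam.1 _), ← hlama, ← pow_mul, ← pow_add]
    exact pow_le_pow_of_le_one hlam.1.le hlam.2.le (by grind)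
  calc ‖(Q - Qh N) δ‖ ≤ C * a ^ n * ‖δ‖ + C * a ^ n * ‖δ‖ := by
        rw [key]
        exact (norm_sub_le _ _).trans (add_le_add (ContinuousLinearMap.le_of_opNorm_le _ h1 δ)
          (ContinuousLinearMap.le_of_opNorm_le _ h2 δ))
    _ = 2 * C * ‖δ‖ * a ^ n := by ring
    _ ≤ 2 * C * ‖δ‖ * (lam ^ N / lam ^ (M + b)) := by gcongr
    _ = 2 * C * ‖δ‖ / lam ^ (M + b) * lam ^ N := by ring
end

section
/- Let P(z,w) = Σ_{j=-n}^{n} p_j(w) z^j, where each p_j is a Laurent polynomial in w, be real-valued and nonnegative on the bitorus |z| = |w| = 1. Assume P has no simple factors, i.e., there is no w₀ with |w₀| = 1 such that P(z,w₀) = 0 for all |z| = 1, and there is no z₀ with |z₀| = 1 such that P(z₀,w) = 0 for all |w| = 1. Then for every m ≥ 1 and every w with |w| = 1, the m×m Toeplitz matrix T_m(w) = (p_{i−j}(w))_{1 ≤ i,j ≤ m} (with p_k := 0 for |k| > n) is positive definite. -/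
open scoped ComplexOrder
open Finset

/-- Orthogonality of the characters of the group of `N`-th roots of unity. -/
lemma IsPrimitiveRoot.sum_zpow_pow {ω : ℂ} {N : ℕ} (hω : IsPrimitiveRoot ω N) {d : ℤ}
    (hd : |d| < N) :
    ∑ t ∈ Finset.range N, (ω ^ t) ^ d = if d = 0 then (N : ℂ) else 0 := by
  split_ifs with h
  · simp [h]
  · have h1 : ω ^ d ≠ 1 := fun h1 =>
      h (Int.eq_zero_of_abs_lt_dvd ((hω.zpow_eq_one_iff_dvd d).1 h1) hd)
    have h2 : ∀ t ∈ Finset.range N, (ω ^ t) ^ d = (ω ^ d) ^ t := fun t _ => by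
      rw [← zpow_natCast, ← zpow_natCast, ← zpow_mul, ← zpow_mul, mul_comm]
    have h3 : (ω ^ d) ^ N = 1 := by
      rw [← zpow_natCast, ← zpow_mul, mul_comm, zpow_mul, zpow_natCast, hω.pow_eq_one, one_zpow]
    rw [Finset.sum_congr rfl h2, geom_sum_eq h1, h3, sub_self, zero_div]

/-- The coefficients of a Laurent polynomial as discrete Fourier coefficients. -/
lemma IsPrimitiveRoot.sum_laurent_mul_zpow {ω : ℂ} {N : ℕ} (hω : IsPrimitiveRoot ω N)
    (hω0 : ω ≠ 0) {n : ℕ} {a : ℤ → ℂ} (ha : ∀ k : ℤ, (n : ℤ) < |k| → a k = 0) {d : ℤ}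
    (hd : n + |d| < N) :
    ∑ t ∈ Finset.range N, (∑ k ∈ Finset.Icc (-(n : ℤ)) n, a k * (ω ^ t) ^ k) * (ω ^ t) ^ (-d)
      = N * a d := by
  simp_rw [Finset.sum_mul, mul_assoc, ← zpow_add₀ (pow_ne_zero _ hω0)]
  rw [Finset.sum_comm]
  have h : ∀ k ∈ Finset.Icc (-(n : ℤ)) n, ∑ t ∈ Finset.range N, a k * (ω ^ t) ^ (k + -d)
      = if k = d then N * a d else 0 := fun k hk => by
    have hk' : |k| ≤ n := abs_le.2 (Finset.mem_Icc.1 hk)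
    have hkd : |k + -d| < N := by
      have := abs_add_le k (-d)
      rw [abs_neg] at this
      linarith
    rw [← Finset.mul_sum, hω.sum_zpow_pow hkd]
    by_cases hh : k = d
    · simp [hh, mul_comm]
    · rw [if_neg (by omega), if_neg hh, mul_zero]
  rw [Finset.sum_congr rfl h, Finset.sum_ite_eq']
  split_ifs with hd'
  · rfl
  · rw [ha d, mul_zero]
    by_contra! hc
    exact hd' (Finset.mem_Icc.2 (abs_le.1 hc))

/-- If the product of a Laurent polynomial `f` of degree at most `n` and a polynomial `g` of degree
less than `m` vanishes at all `N`-th roots of unity, `2 * n + m ≤ N`, then `f` vanishes on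
`ℂ \ {0}` or `g` is zero. -/
lemma IsPrimitiveRoot.laurent_eq_zero_or_eq_zero {ω : ℂ} {N : ℕ} (hω : IsPrimitiveRoot ω N)
    (hω0 : ω ≠ 0) {n m : ℕ} (hm : 1 ≤ m) (hN : 2 * n + m ≤ N) (a : ℤ → ℂ) (x : Fin m → ℂ)
    (h : ∀ t < N, (∑ k ∈ Finset.Icc (-(n : ℤ)) n, a k * (ω ^ t) ^ k)
      * (∑ j : Fin m, x j * (ω ^ t) ^ (j : ℕ)) = 0) :
    (∀ z : ℂ, z ≠ 0 → ∑ k ∈ Finset.Icc (-(n : ℤ)) n, a k * z ^ k = 0) ∨ x = 0 := by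
  let F : Polynomial ℂ := ∑ k ∈ Finset.Icc (-(n : ℤ)) n, Polynomial.monomial (k + n).toNat (a k)
  let G : Polynomial ℂ := ∑ j : Fin m, Polynomial.monomial (j : ℕ) (x j)
  have hF : ∀ z : ℂ, z ≠ 0 →
      F.eval z = z ^ n * ∑ k ∈ Finset.Icc (-(n : ℤ)) n, a k * z ^ k := fun z hz => by
    simp only [F, Polynomial.eval_finsetSum, Polynomial.eval_monomial, Finset.mul_sum]
    refine Finset.sum_congr rfl fun k hk => ?_
    have hk' := Finset.mem_Icc.1 hk
    rw [← zpow_natCast, Int.toNat_of_nonneg (by omega), zpow_add₀ hz, zpow_natCast]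
    ring
  have hG : ∀ z : ℂ, G.eval z = ∑ j : Fin m, x j * z ^ (j : ℕ) := fun z => by
    simp only [G, Polynomial.eval_finsetSum, Polynomial.eval_monomial]
  have hFd : F.natDegree ≤ 2 * n := Polynomial.natDegree_sum_le_of_forall_le _ _ fun k hk => by
    have hk' := Finset.mem_Icc.1 hk
    exact (Polynomial.natDegree_monomial_le _).trans (by omega)
  have hGd : G.natDegree ≤ m - 1 := Polynomial.natDegree_sum_le_of_forall_le _ _ fun j _ =>
    (Polynomial.natDegree_monomial_le _).trans (by omega)
  have hFG : F * G = 0 := by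
    refine Polynomial.eq_zero_of_natDegree_lt_card_of_eval_eq_zero (F * G)
      (f := fun t : Fin N => ω ^ (t : ℕ))
      (fun s t hst => Fin.ext (hω.pow_inj s.2 t.2 hst)) (fun t => ?_) ?_
    · rw [Polynomial.eval_mul, hF _ (pow_ne_zero _ hω0), hG, mul_assoc, h t t.2, mul_zero]
    · have := Polynomial.natDegree_mul_le (p := F) (q := G)
      rw [Fintype.card_fin]
      omega
  rcases mul_eq_zero.1 hFG with h0 | h0
  · left
    intro z hz
    have := hF z hz
    rw [h0, Polynomial.eval_zero] at this
    exact (mul_eq_zero.1 this.symm).resolve_left (pow_ne_zero _ hz)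
  · right
    funext j
    have := congrArg (fun q : Polynomial ℂ => q.coeff j) h0
    simpa [G, Polynomial.finsetSum_coeff, Polynomial.coeff_monomial, Fin.val_inj] using this

/-- The Toeplitz matrices of a trigonometric polynomial that is nonnegative and not identically
zero on the unit circle are positive definite. -/
lemma Matrix.posDef_toeplitz_of_laurent_nonneg {n : ℕ} {a : ℤ → ℂ}
    (ha : ∀ k : ℤ, (n : ℤ) < |k| → a k = 0)
    (hnonneg : ∀ z : ℂ, ‖z‖ = 1 → 0 ≤ ∑ k ∈ Finset.Icc (-(n : ℤ)) n, a k * z ^ k)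
    (hne : ∃ z : ℂ, ‖z‖ = 1 ∧ ∑ k ∈ Finset.Icc (-(n : ℤ)) n, a k * z ^ k ≠ 0)
    {m : ℕ} (hm : 1 ≤ m) :
    (Matrix.of fun i j : Fin m => a ((i : ℤ) - (j : ℤ))).PosDef := by
  set f : ℂ → ℂ := fun z => ∑ k ∈ Finset.Icc (-(n : ℤ)) n, a k * z ^ k with hf
  set N : ℕ := 2 * n + m with hN
  have hN0 : N ≠ 0 := by omega
  obtain ⟨ω, hω⟩ : ∃ ω : ℂ, IsPrimitiveRoot ω N := ⟨_, Complex.isPrimitiveRoot_exp N hN0⟩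
  have hω0 : ω ≠ 0 := hω.ne_zero hN0
  have hnorm : ∀ t : ℕ, ‖ω ^ t‖ = 1 := fun t => by
    rw [norm_pow, hω.norm'_eq_one hN0, one_pow]
  have hconj : ∀ (t : ℕ) (d : ℤ), star ((ω ^ t) ^ d) = (ω ^ t) ^ (-d) := fun t d => by
    rw [star_zpow₀, _root_.zpow_neg, ← _root_.inv_zpow, Complex.inv_eq_conj (hnorm t)]
    rfl
  have hf0 : ∀ t : ℕ, 0 ≤ f (ω ^ t) := fun t => hnonneg _ (hnorm t)
  have hcoef : ∀ i j : Fin m, (N : ℂ) * a ((i : ℤ) - (j : ℤ))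
      = ∑ t ∈ Finset.range N, f (ω ^ t) * (ω ^ t) ^ (-((i : ℤ) - (j : ℤ))) := fun i j => by
    refine (hω.sum_laurent_mul_zpow hω0 ha ?_).symm
    have : |(i : ℤ) - (j : ℤ)| < m := abs_lt.2 ⟨by omega, by omega⟩
    push_cast [hN]
    omega
  have hNC : (N : ℂ) ≠ 0 := Nat.cast_ne_zero.2 hN0
  refine Matrix.PosDef.of_dotProduct_mulVec_pos ?_ fun x hx => ?_
  · ext i j
    rw [Matrix.conjTranspose_apply, Matrix.of_apply, Matrix.of_apply]
    apply mul_left_cancel₀ hNC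
    have hs : star (N : ℂ) = N := star_natCast N
    rw [hcoef i j, ← hs, ← star_mul', hcoef j i, star_sum]
    refine Finset.sum_congr rfl fun t _ => ?_
    rw [star_mul', hconj, (IsSelfAdjoint.of_nonneg (hf0 t)).star_eq]
    ring_nf
  · set g : ℕ → ℂ := fun t => ∑ j : Fin m, x j * (ω ^ t) ^ (j : ℕ) with hg
    have hgstar : ∀ t, star (g t) = ∑ i : Fin m, star (x i) * (ω ^ t) ^ (-(i : ℤ)) := fun t => by
      rw [hg, star_sum]
      refine Finset.sum_congr rfl fun i _ => ?_
      rw [star_mul', ← hconj, zpow_natCast]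
    have hquad : (N : ℂ) * (star x ⬝ᵥ (Matrix.of fun i j : Fin m => a ((i : ℤ) - (j : ℤ))).mulVec x)
        = ∑ t ∈ Finset.range N, f (ω ^ t) * (star (g t) * g t) := by
      have hr : ∀ t ∈ Finset.range N, f (ω ^ t) * (star (g t) * g t) = ∑ i : Fin m, ∑ j : Fin m,
          star (x i) * x j * (f (ω ^ t) * (ω ^ t) ^ (-((i : ℤ) - (j : ℤ)))) := fun t _ => by
        rw [hgstar, hg, Finset.sum_mul_sum, Finset.mul_sum]
        refine Finset.sum_congr rfl fun i _ => ?_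
        rw [Finset.mul_sum]
        refine Finset.sum_congr rfl fun j _ => ?_
        rw [neg_sub, sub_eq_neg_add, zpow_add₀ (pow_ne_zero _ hω0), zpow_natCast]
        ring
      rw [Finset.sum_congr rfl hr, Finset.sum_comm]
      simp only [dotProduct, Matrix.mulVec, Matrix.of_apply, Pi.star_apply, Finset.mul_sum]
      refine Finset.sum_congr rfl fun i _ => ?_
      rw [Finset.sum_comm]
      refine Finset.sum_congr rfl fun j _ => ?_
      rw [← Finset.mul_sum, ← hcoef]
      ring
    have hterm : ∀ t ∈ Finset.range N, 0 ≤ f (ω ^ t) * (star (g t) * g t) := fun t _ =>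
      mul_nonneg (hf0 t) (star_mul_self_nonneg _)
    have hpos : 0 < ∑ t ∈ Finset.range N, f (ω ^ t) * (star (g t) * g t) := by
      refine lt_of_le_of_ne (Finset.sum_nonneg hterm) fun h0 => ?_
      have hz := (Finset.sum_eq_zero_iff_of_nonneg hterm).1 h0.symm
      have hfg : ∀ t < N, f (ω ^ t) * g t = 0 := fun t ht => by
        have h1 := hz t (Finset.mem_range.2 ht)
        rw [mul_eq_zero, mul_eq_zero, star_eq_zero, or_self] at h1
        exact mul_eq_zero.2 h1
      rcases hω.laurent_eq_zero_or_eq_zero hω0 hm le_rfl a x hfg with h1 | h1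
      · obtain ⟨z, hz1, hz2⟩ := hne
        exact hz2 (h1 z (norm_ne_zero_iff.1 (by rw [hz1]; exact one_ne_zero)))
      · exact hx h1
    rw [← hquad] at hpos
    exact pos_of_mul_pos_right hpos (Nat.cast_nonneg N)

/-- Lemma 5.1 of the paper: if `P(z,w) = ∑_{j=-n}^n p_j(w) z^j` is nonnegative on the bitorus
and has no simple factors, then for every `m ≥ 1` and every `w` on the unit circle the `m × m`
Toeplitz matrix `T_m(w) = (p_{i-j}(w))` is positive definite. -/
theorem stmt_6 (n nw : ℕ) (c : ℤ → ℤ → ℂ)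
    (hband : ∀ k : ℤ, |k| > (n : ℤ) → ∀ l : ℤ, c k l = 0)
    (p : ℤ → ℂ → ℂ)
    (hp : ∀ (k : ℤ) (w : ℂ), p k w = ∑ l ∈ Finset.Icc (-(nw : ℤ)) nw, c k l * w ^ l)
    (P : ℂ → ℂ → ℂ)
    (hP : ∀ z w : ℂ, P z w = ∑ k ∈ Finset.Icc (-(n : ℤ)) n, p k w * z ^ k)
    (hpos : ∀ z w : ℂ, ‖z‖ = 1 → ‖w‖ = 1 → (P z w).im = 0 ∧ 0 ≤ (P z w).re)
    (hnfw : ¬ ∃ w₀ : ℂ, ‖w₀‖ = 1 ∧ ∀ z : ℂ, ‖z‖ = 1 → P z w₀ = 0)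
    (hnfz : ¬ ∃ z₀ : ℂ, ‖z₀‖ = 1 ∧ ∀ w : ℂ, ‖w‖ = 1 → P z₀ w = 0) :
    ∀ (m : ℕ), 1 ≤ m → ∀ w : ℂ, ‖w‖ = 1 →
      Matrix.PosDef (Matrix.of (fun i j : Fin m => p ((i : ℤ) - (j : ℤ)) w)) := by
  intro m hm w hw
  push Not at hnfw
  obtain ⟨z₀, hz₀, hPz₀⟩ := hnfw w hw
  refine Matrix.posDef_toeplitz_of_laurent_nonneg (n := n) (a := fun k => p k w) (fun k hk => ?_)
    (fun z hz => ?_) ⟨z₀, hz₀, ?_⟩ hm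
  · simp [hp, hband k hk]
  · rw [← hP]
    exact Complex.nonneg_iff.2 ⟨(hpos z w hz hw).2, (hpos z w hz hw).1.symm⟩
  · rw [← hP]
    exact hPz₀
end

section
/- Let P(z_1,z_2) = Σ_{k=-n_1}^{n_1} p_k(z_2) z_1^k, where each p_k is a Laurent polynomial in z_2, be real-valued with P(z_1,z_2) ≥ ε > 0 on the bitorus |z_1| = |z_2| = 1. Set C_1 = sup{ |p_k(z_2)| : −n_1 ≤ k ≤ n_1, |z_2| = 1 }, and let m_1 > n_1 be an integer with n_1(n_1+1)C_1/(m_1 − n_1) < ε. For |z_2| = 1, let P_{m_1}(z_2) be the (m_1+1)×(m_1+1) matrix with (j,k) entry p_{k−j}(z_2)/(m_1+1−|j−k|) for |j−k| ≤ n_1 and 0 otherwise (0 ≤ j,k ≤ m_1). Then: (i) for all |z_1| = |z_2| = 1, P(z_1,z_2) = 𝐳₁† P_{m_1}(z_2) 𝐳₁, where 𝐳₁ = (1, z_1, z_1², …, z_1^{m_1})ᵀ; and (ii) for every |z_2| = 1 and every nonzero x ∈ ℂ^{m_1+1}, x† P_{m_1}(z_2) x ≥ (ε − n_1(n_1+1)C_1/(m_1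 − n_1)) ‖x‖² / (m_1+1) > 0; in particular P_{m_1}(z_2) is positive definite. -/
open scoped ComplexOrder
open Finset

theorem sum_pow_zpow_primitiveRoot {N : ℕ} {ζ : ℂ} (hζ : IsPrimitiveRoot ζ N) {n : ℤ}
    (hn : |n| < N) :
    ∑ t ∈ range N, (ζ ^ t) ^ n = if n = 0 then (N : ℂ) else 0 := by
  split_ifs with h
  · simp [h]
  · have hne : ζ ^ n ≠ 1 := fun h1 =>
      h (Int.eq_zero_of_abs_lt_dvd ((hζ.zpow_eq_one_iff_dvd n).1 h1) hn)
    have hcomm : ∀ t : ℕ, (ζ ^ t) ^ n = (ζ ^ n) ^ t := fun t => by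
      rw [← zpow_natCast, ← zpow_natCast, zpow_comm]
    have hmul := geom_sum_mul (ζ ^ n) N
    rw [← hcomm, hζ.pow_eq_one, one_zpow, sub_self] at hmul
    simp_rw [hcomm]
    exact (mul_eq_zero.1 hmul).resolve_right (sub_ne_zero.2 hne)

theorem sum_laurent_mul_zpow_primitiveRoot {n N : ℕ} {ζ : ℂ} (hζ : IsPrimitiveRoot ζ N)
    (hN : N ≠ 0) (a : ℤ → ℂ) (ha : ∀ d : ℤ, (n : ℤ) < |d| → a d = 0) {e : ℤ}
    (he : |e| + n < N) :
    ∑ t ∈ range N, (∑ d ∈ Icc (-(n : ℤ)) n, a d * (ζ ^ t) ^ d) * (ζ ^ t) ^ (-e) =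
      N * a e := by
  have hζ0 : ζ ≠ 0 := hζ.ne_zero hN
  simp_rw [sum_mul]
  rw [sum_comm]
  have hd : ∀ d ∈ Icc (-(n : ℤ)) n, ∑ t ∈ range N, a d * (ζ ^ t) ^ d * (ζ ^ t) ^ (-e) =
      if d = e then N * a d else 0 := fun d hd => by
    have hde : |d + -e| < N := by
      have := abs_add_le d (-e)
      have := abs_le.2 (mem_Icc.1 hd)
      rw [abs_neg] at *
      omega
    simp_rw [mul_assoc, ← mul_sum, ← zpow_add₀ (pow_ne_zero _ hζ0)]
    rw [sum_pow_zpow_primitiveRoot hζ hde]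
    simp only [add_neg_eq_zero]
    split_ifs <;> ring
  rw [sum_congr rfl hd, sum_ite_eq']
  split_ifs with h
  · rfl
  · rw [ha e, mul_zero]
    by_contra! h'
    exact h (mem_Icc.2 (abs_le.1 h'))

theorem toeplitz_form_re_nonneg {n m : ℕ} (a : ℤ → ℂ)
    (ha : ∀ d : ℤ, (n : ℤ) < |d| → a d = 0)
    (hpos : ∀ z : ℂ, ‖z‖ = 1 → (∑ d ∈ Icc (-(n : ℤ)) n, a d * z ^ d).im = 0 ∧
      0 ≤ (∑ d ∈ Icc (-(n : ℤ)) n, a d * z ^ d).re)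
    (x : Fin (m + 1) → ℂ) :
    0 ≤ (∑ j : Fin (m + 1), ∑ k : Fin (m + 1),
      starRingEnd ℂ (x j) * a ((k : ℤ) - (j : ℤ)) * x k).re := by
  obtain ⟨N, hN⟩ : ∃ N, N = n + m + 1 := ⟨_, rfl⟩
  have hN0 : N ≠ 0 := by omega
  have hζ := Complex.isPrimitiveRoot_exp N hN0
  set ζ := Complex.exp (2 * Real.pi * Complex.I / N)
  have hnorm : ∀ t : ℕ, ‖ζ ^ t‖ = 1 := fun t => by
    rw [norm_pow, hζ.norm'_eq_one hN0, one_pow]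
  set Q : ℂ → ℂ := fun z => ∑ d ∈ Icc (-(n : ℤ)) n, a d * z ^ d with hQ
  have key : (N : ℂ) * ∑ j : Fin (m + 1), ∑ k : Fin (m + 1),
      starRingEnd ℂ (x j) * a ((k : ℤ) - (j : ℤ)) * x k =
      ∑ t ∈ range N, Q (ζ ^ t) *
        (Complex.normSq (∑ k : Fin (m + 1), x k * (ζ ^ t) ^ (-(k : ℤ))) : ℂ) := by
    have hterm : ∀ t ∈ range N, Q (ζ ^ t) *
        (Complex.normSq (∑ k : Fin (m + 1), x k * (ζ ^ t) ^ (-(k : ℤ))) : ℂ) =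
        ∑ j : Fin (m + 1), ∑ k : Fin (m + 1), starRingEnd ℂ (x j) * x k *
          (Q (ζ ^ t) * (ζ ^ t) ^ (-((k : ℤ) - (j : ℤ)))) := fun t _ => by
      have hz : ζ ^ t ≠ 0 := pow_ne_zero _ (hζ.ne_zero hN0)
      have hconj : starRingEnd ℂ (ζ ^ t) = (ζ ^ t)⁻¹ :=
        (Complex.inv_eq_conj (hnorm t)).symm
      rw [Complex.normSq_eq_conj_mul_self, map_sum, sum_mul_sum, mul_sum]
      refine sum_congr rfl fun j _ => ?_
      rw [mul_sum]
      refine sum_congr rfl fun k _ => ?_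
      rw [map_mul, map_zpow₀, hconj, neg_sub, sub_eq_add_neg (j : ℤ), zpow_add₀ hz,
        inv_zpow', neg_neg]
      ring
    rw [sum_congr rfl hterm, mul_sum, sum_comm (s := range N)]
    refine sum_congr rfl fun j _ => ?_
    rw [mul_sum, sum_comm (s := range N)]
    refine sum_congr rfl fun k _ => ?_
    rw [← mul_sum, sum_laurent_mul_zpow_primitiveRoot hζ hN0 a ha]
    · ring
    · have := j.isLt
      have := k.isLt
      have : |(k : ℤ) - (j : ℤ)| ≤ m := abs_le.2 ⟨by omega, by omega⟩
      omega
  have hre := congrArg Complex.re key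
  rw [← Complex.ofReal_natCast, Complex.re_ofReal_mul] at hre
  refine nonneg_of_mul_nonneg_right (hre.symm ▸ ?_)
    (Nat.cast_pos.2 (Nat.pos_of_ne_zero hN0) : (0 : ℝ) < N)
  rw [Complex.re_sum]
  refine sum_nonneg fun t _ => ?_
  rw [Complex.re_mul_ofReal]
  exact mul_nonneg (hpos _ (hnorm t)).2 (Complex.normSq_nonneg _)

theorem conj_laurent_coeff {n : ℕ} (a : ℤ → ℂ) (ha : ∀ d : ℤ, (n : ℤ) < |d| → a d = 0)
    (hreal : ∀ z : ℂ, ‖z‖ = 1 → (∑ d ∈ Icc (-(n : ℤ)) n, a d * z ^ d).im = 0) (e : ℤ) :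
    starRingEnd ℂ (a e) = a (-e) := by
  obtain ⟨N, hN⟩ : ∃ N, N = e.natAbs + n + 1 := ⟨_, rfl⟩
  have hN0 : N ≠ 0 := by omega
  have hζ := Complex.isPrimitiveRoot_exp N hN0
  set ζ := Complex.exp (2 * Real.pi * Complex.I / N)
  have hnorm : ∀ t : ℕ, ‖ζ ^ t‖ = 1 := fun t => by
    rw [norm_pow, hζ.norm'_eq_one hN0, one_pow]
  have h1 := sum_laurent_mul_zpow_primitiveRoot hζ hN0 a ha (e := e)
    (by rw [Int.abs_eq_natAbs]; omega)
  have h2 := sum_laurent_mul_zpow_primitiveRoot hζ hN0 a ha (e := -e)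
    (by rw [abs_neg, Int.abs_eq_natAbs]; omega)
  have hNC : (N : ℂ) ≠ 0 := Nat.cast_ne_zero.2 hN0
  refine mul_left_cancel₀ hNC ?_
  rw [← h2, ← map_natCast (starRingEnd ℂ) N, ← map_mul, ← h1, map_sum]
  refine sum_congr rfl fun t _ => ?_
  rw [map_mul, Complex.conj_eq_iff_im.2 (hreal _ (hnorm t)), map_zpow₀,
    ← Complex.inv_eq_conj (hnorm t), inv_zpow']

theorem card_fin_diag {m : ℕ} {d : ℤ} (hd : |d| ≤ m) :
    ((#{q : Fin (m + 1) × Fin (m + 1) | (q.2 : ℤ) - (q.1 : ℤ) = d} : ℕ) : ℤ) =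
      m + 1 - |d| := by
  have hcard : #{q : Fin (m + 1) × Fin (m + 1) | (q.2 : ℤ) - (q.1 : ℤ) = d} =
      #(Icc (max 0 (-d)) (min (m : ℤ) (m - d))) := by
    refine card_bij (fun q _ => (q.1 : ℤ)) ?_ ?_ ?_
    · rintro ⟨j, k⟩ h
      simp only [mem_filter, mem_univ, true_and] at h
      have := j.isLt
      have := k.isLt
      simp only [mem_Icc]
      omega
    · rintro ⟨j, k⟩ h ⟨j', k'⟩ h' hjj
      simp only [mem_filter, mem_univ, true_and] at h h' hjj
      ext <;> simp only <;> omega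
    · intro b hb
      simp only [mem_Icc] at hb
      refine ⟨(⟨b.toNat, by omega⟩, ⟨(b + d).toNat, by omega⟩), ?_, ?_⟩
      · simp only [mem_filter, mem_univ, true_and]
        omega
      · simp only
        omega
  rw [hcard, Int.card_Icc]
  rcases abs_cases d with h | h <;> omega

theorem sum_fin_sub_eq_sum_diag {n m : ℕ} (hnm : n ≤ m) (f : ℤ → ℂ)
    (hf : ∀ d : ℤ, (n : ℤ) < |d| → f d = 0) :
    ∑ j : Fin (m + 1), ∑ k : Fin (m + 1), f ((k : ℤ) - (j : ℤ)) =
      ∑ d ∈ Icc (-(n : ℤ)) n, ((m : ℂ) + 1 - (|d| : ℤ)) * f d := by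
  have hfib : ∀ j k : Fin (m + 1), f ((k : ℤ) - (j : ℤ)) =
      ∑ d ∈ Icc (-(n : ℤ)) n, if (k : ℤ) - (j : ℤ) = d then f d else 0 := fun j k => by
    rw [sum_ite_eq]
    split_ifs with h
    · rfl
    · refine hf _ ?_
      by_contra! h'
      exact h (mem_Icc.2 (abs_le.1 h'))
  simp_rw [hfib]
  rw [← sum_product', univ_product_univ, sum_comm]
  refine sum_congr rfl fun d hd => ?_
  have hdn : |d| ≤ n := abs_le.2 (mem_Icc.1 hd)
  have hcard := congrArg (Int.cast : ℤ → ℂ) (card_fin_diag (m := m) (d := d) (by omega))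
  push_cast at hcard
  rw [← sum_filter, sum_const, nsmul_eq_mul, hcard]

theorem sum_Icc_neg_abs (n : ℕ) : ∑ d ∈ Icc (-(n : ℤ)) n, ((|d| : ℤ) : ℝ) = n * (n + 1) := by
  induction n with
  | zero => simp
  | succ n ih =>
    have hI : Icc (-((n + 1 : ℕ) : ℤ)) ((n + 1 : ℕ) : ℤ) =
        insert (-((n : ℤ) + 1)) (insert ((n : ℤ) + 1) (Icc (-(n : ℤ)) n)) := by
      ext d
      simp only [mem_Icc, mem_insert]
      omega
    rw [hI, sum_insert (by simp only [mem_insert, mem_Icc]; omega),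
      sum_insert (by simp only [mem_Icc]; omega), ih, abs_neg,
      abs_of_nonneg (by positivity : (0 : ℤ) ≤ n + 1)]
    push_cast
    ring

theorem norm_form_le_of_toeplitz_bound {n m : ℕ}
    (E : Fin (m + 1) → Fin (m + 1) → ℂ) (w : ℤ → ℝ) (hw : ∀ d, 0 ≤ w d)
    (hsupp : ∀ d : ℤ, (n : ℤ) < |d| → w d = 0) (hsymm : ∀ d, w (-d) = w d)
    (hE : ∀ j k, ‖E j k‖ ≤ w ((k : ℤ) - (j : ℤ))) (x : Fin (m + 1) → ℂ) :
    ‖∑ j, ∑ k, starRingEnd ℂ (x j) * E j k * x k‖ ≤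
      (∑ d ∈ Icc (-(n : ℤ)) n, w d) * ∑ j, ‖x j‖ ^ 2 := by
  set W := ∑ d ∈ Icc (-(n : ℤ)) n, w d
  have hrow : ∀ j : Fin (m + 1), ∑ k : Fin (m + 1), w ((k : ℤ) - (j : ℤ)) ≤ W := fun j => by
    have hinj : Function.Injective fun k : Fin (m + 1) => (k : ℤ) - (j : ℤ) := fun k k' h => by
      ext
      simp only at h
      omega
    rw [← sum_image (f := w) (s := univ) (g := fun k : Fin (m + 1) => (k : ℤ) - (j : ℤ))
      hinj.injOn]
    rw [← sum_filter_ne_zero]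
    refine sum_le_sum_of_subset_of_nonneg (fun d hd => ?_) fun d _ _ => hw d
    by_contra h
    refine (mem_filter.1 hd).2 (hsupp d ?_)
    by_contra! h'
    exact h (mem_Icc.2 (abs_le.1 h'))
  have hentry : ∀ j k : Fin (m + 1), ‖starRingEnd ℂ (x j) * E j k * x k‖ ≤
      ‖x j‖ ^ 2 / 2 * w ((k : ℤ) - (j : ℤ)) + ‖x k‖ ^ 2 / 2 * w ((j : ℤ) - (k : ℤ)) :=
    fun j k => by
      rw [norm_mul, norm_mul, RCLike.norm_conj, ← neg_sub (k : ℤ), hsymm]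
      have h1 : ‖x j‖ * ‖E j k‖ * ‖x k‖ ≤ ‖x j‖ * w ((k : ℤ) - (j : ℤ)) * ‖x k‖ := by
        gcongr
        exact hE j k
      have h2 := mul_nonneg (sq_nonneg (‖x j‖ - ‖x k‖)) (hw ((k : ℤ) - (j : ℤ)))
      nlinarith
  have hhalf : ∑ j : Fin (m + 1), ∑ k : Fin (m + 1), ‖x j‖ ^ 2 / 2 * w ((k : ℤ) - (j : ℤ)) ≤
      W * (∑ j, ‖x j‖ ^ 2) / 2 := by
    simp_rw [← mul_sum]
    rw [mul_sum, sum_div]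
    refine sum_le_sum fun j _ => ?_
    have := mul_le_mul_of_nonneg_left (hrow j) (by positivity : 0 ≤ ‖x j‖ ^ 2 / 2)
    linarith
  calc ‖∑ j, ∑ k, starRingEnd ℂ (x j) * E j k * x k‖
      ≤ ∑ j, ∑ k, ‖starRingEnd ℂ (x j) * E j k * x k‖ :=
        norm_sum_le_of_le _ fun j _ => norm_sum_le _ _
    _ ≤ ∑ j : Fin (m + 1), ∑ k : Fin (m + 1), (‖x j‖ ^ 2 / 2 * w ((k : ℤ) - (j : ℤ)) +
          ‖x k‖ ^ 2 / 2 * w ((j : ℤ) - (k : ℤ))) :=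
        sum_le_sum fun j _ => sum_le_sum fun k _ => hentry j k
    _ ≤ W * ∑ j, ‖x j‖ ^ 2 := by
        simp_rw [sum_add_distrib]
        rw [sum_comm (f := fun j k : Fin (m + 1) => ‖x k‖ ^ 2 / 2 * w ((j : ℤ) - (k : ℤ)))]
        linarith

/-- The averaged matrix representation of the Laurent polynomial with coefficients `a`. -/
noncomputable def averagedMatrix (m : ℕ) (a : ℤ → ℂ) : Matrix (Fin (m + 1)) (Fin (m + 1)) ℂ :=
  Matrix.of fun j k => a ((k : ℤ) - (j : ℤ)) / ((m : ℂ) + 1 - (|(k : ℤ) - (j : ℤ)| : ℤ))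

theorem sum_averagedMatrix_zpow {n m : ℕ} (hnm : n ≤ m) (a : ℤ → ℂ)
    (ha : ∀ d : ℤ, (n : ℤ) < |d| → a d = 0) {z : ℂ} (hz : ‖z‖ = 1) :
    ∑ j : Fin (m + 1), ∑ k : Fin (m + 1),
      starRingEnd ℂ (z ^ (j : ℕ)) * averagedMatrix m a j k * z ^ (k : ℕ) =
      ∑ d ∈ Icc (-(n : ℤ)) n, a d * z ^ d := by
  have hz0 : z ≠ 0 := norm_ne_zero_iff.1 (by rw [hz]; exact one_ne_zero)
  have hterm : ∀ j k : Fin (m + 1),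
      starRingEnd ℂ (z ^ (j : ℕ)) * averagedMatrix m a j k * z ^ (k : ℕ) =
      (fun d : ℤ => a d / ((m : ℂ) + 1 - (|d| : ℤ)) * z ^ d) ((k : ℤ) - (j : ℤ)) := fun j k => by
    simp only [averagedMatrix, Matrix.of_apply]
    rw [map_pow, ← Complex.inv_eq_conj hz, zpow_sub₀ hz0, zpow_natCast, zpow_natCast, inv_pow]
    ring
  simp_rw [hterm]
  rw [sum_fin_sub_eq_sum_diag hnm (fun d : ℤ => a d / ((m : ℂ) + 1 - (|d| : ℤ)) * z ^ d)
    fun d hd => by simp [ha d hd]]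
  refine sum_congr rfl fun d hd => ?_
  have hdn : |d| ≤ n := abs_le.2 (mem_Icc.1 hd)
  have hne : (m : ℂ) + 1 - (|d| : ℤ) ≠ 0 := by
    have : (m : ℤ) + 1 - |d| ≠ 0 := by omega
    exact_mod_cast this
  rw [← mul_assoc, mul_div_cancel₀ _ hne]

theorem averagedMatrix_isHermitian {m : ℕ} (a : ℤ → ℂ)
    (ha : ∀ d, starRingEnd ℂ (a d) = a (-d)) : (averagedMatrix m a).IsHermitian := by
  ext j k
  simp only [averagedMatrix, Matrix.conjTranspose_apply, Matrix.of_apply, RCLike.star_def]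
  rw [map_div₀, ha, neg_sub, abs_sub_comm (j : ℤ)]
  simp

theorem le_averagedMatrix_form_re {n m : ℕ} (hnm : n < m) (a : ℤ → ℂ)
    (ha : ∀ d : ℤ, (n : ℤ) < |d| → a d = 0) {ε C : ℝ} (hC : ∀ d, ‖a d‖ ≤ C)
    (hpos : ∀ z : ℂ, ‖z‖ = 1 → (∑ d ∈ Icc (-(n : ℤ)) n, a d * z ^ d).im = 0 ∧
      ε ≤ (∑ d ∈ Icc (-(n : ℤ)) n, a d * z ^ d).re)
    (x : Fin (m + 1) → ℂ) :
    (ε - (n : ℝ) * (n + 1) * C / ((m : ℝ) - n)) * (∑ j, ‖x j‖ ^ 2) / ((m : ℝ) + 1) ≤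
      (∑ j, ∑ k, starRingEnd ℂ (x j) * averagedMatrix m a j k * x k).re := by
  have hC0 : 0 ≤ C := (norm_nonneg _).trans (hC 0)
  have hmn : (0 : ℝ) < (m : ℝ) - n := sub_pos.2 (Nat.cast_lt.2 hnm)
  have hm : (0 : ℝ) < (m : ℝ) + 1 := by positivity
  set S := ∑ j, ‖x j‖ ^ 2 with hS
  set T := ∑ j : Fin (m + 1), ∑ k : Fin (m + 1),
    starRingEnd ℂ (x j) * a ((k : ℤ) - (j : ℤ)) * x k with hT
  have hToep : ε * S ≤ T.re := by
    have hshift : ∀ z : ℂ, ∑ d ∈ Icc (-(n : ℤ)) n, (a d - if d = 0 then (ε : ℂ) else 0) * z ^ d =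
        (∑ d ∈ Icc (-(n : ℤ)) n, a d * z ^ d) - ε := fun z => by
      simp_rw [sub_mul, sum_sub_distrib, ite_mul, zero_mul, sum_ite_eq']
      simp
    have h := toeplitz_form_re_nonneg (n := n) (fun d => a d - if d = 0 then (ε : ℂ) else 0)
      (fun d hd => by
        have : d ≠ 0 := by rintro rfl; simp at hd; omega
        simp [ha d hd, this])
      (fun z hz => by
        rw [hshift]
        have := hpos z hz
        simpa using this) x
    have hdiag : ∑ j : Fin (m + 1), ∑ k : Fin (m + 1), starRingEnd ℂ (x j) *
        (a ((k : ℤ) - (j : ℤ)) - if (k : ℤ) - (j : ℤ) = 0 then (ε : ℂ) else 0) * x k =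
        T - ((ε * S : ℝ) : ℂ) := by
      have hjk : ∀ j k : Fin (m + 1), (k : ℤ) - (j : ℤ) = 0 ↔ j = k := fun j k => by
        rw [Fin.ext_iff]
        omega
      simp_rw [mul_sub, sub_mul, sum_sub_distrib, hjk, mul_ite, ite_mul, mul_zero, zero_mul,
        sum_ite_eq, mem_univ, if_true]
      rw [hS, mul_sum]
      push_cast
      congr 1
      refine sum_congr rfl fun j _ => ?_
      rw [← Complex.conj_mul']
      ring
    simp only [hdiag, Complex.sub_re, Complex.ofReal_re] at h
    linarith
  set K := C / (((m : ℝ) + 1) * ((m : ℝ) - n)) with hK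
  have hK0 : 0 ≤ K := by positivity
  have hErr := norm_form_le_of_toeplitz_bound (n := n)
    (fun j k : Fin (m + 1) => averagedMatrix m a j k - a ((k : ℤ) - (j : ℤ)) / ((m : ℂ) + 1))
    (fun d => if |d| ≤ n then ((|d| : ℤ) : ℝ) * K else 0)
    (fun d => by split_ifs <;> positivity)
    (fun d hd => if_neg (not_le.2 hd)) (fun d => by simp only [abs_neg])
    (fun j k => by
      simp only [averagedMatrix, Matrix.of_apply]
      generalize (k : ℤ) - (j : ℤ) = d
      split_ifs with hd
      · have hdR : ((|d| : ℤ) : ℝ) ≤ n := by exact_mod_cast hd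
        have hpos' : (0 : ℝ) < (m : ℝ) + 1 - (|d| : ℤ) := by linarith
        have heq : a d / ((m : ℂ) + 1 - (|d| : ℤ)) - a d / ((m : ℂ) + 1) =
            a d * (((|d| : ℤ) / (((m : ℝ) + 1) * ((m : ℝ) + 1 - (|d| : ℤ))) : ℝ) : ℂ) := by
          have h1 : (m : ℂ) + 1 - (|d| : ℤ) ≠ 0 := by exact_mod_cast hpos'.ne'
          have h2 : (m : ℂ) + 1 ≠ 0 := by exact_mod_cast hm.ne'
          rw [Complex.ofReal_div, Complex.ofReal_mul, Complex.ofReal_sub, Complex.ofReal_add,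
            Complex.ofReal_intCast, Complex.ofReal_natCast, Complex.ofReal_one]
          field_simp
          ring
        have hd0 : (0 : ℝ) ≤ ((|d| : ℤ) : ℝ) := by exact_mod_cast abs_nonneg d
        rw [heq, norm_mul, Complex.norm_of_nonneg (by positivity)]
        calc ‖a d‖ * ((|d| : ℤ) / (((m : ℝ) + 1) * ((m : ℝ) + 1 - (|d| : ℤ))))
            ≤ C * ((|d| : ℤ) / (((m : ℝ) + 1) * ((m : ℝ) - n))) := by
              gcongr
              · exact hC d
              · linarith
          _ = (|d| : ℤ) * K := by rw [hK]; ring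
      · simp [ha d (not_le.1 hd)]) x
  have hsum : ∑ d ∈ Icc (-(n : ℤ)) n, (if |d| ≤ (n : ℤ) then ((|d| : ℤ) : ℝ) * K else 0) =
      n * (n + 1) * K := by
    rw [sum_congr rfl fun d hd => if_pos (abs_le.2 (mem_Icc.1 hd)), ← sum_mul, sum_Icc_neg_abs]
  have hsplit : ∑ j, ∑ k, starRingEnd ℂ (x j) *
      (averagedMatrix m a j k - a ((k : ℤ) - (j : ℤ)) / ((m : ℂ) + 1)) * x k =
      (∑ j, ∑ k, starRingEnd ℂ (x j) * averagedMatrix m a j k * x k) -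
        T / (((m : ℝ) + 1 : ℝ) : ℂ) := by
    simp_rw [mul_sub, sub_mul, sum_sub_distrib, hT, sum_div]
    congr 1
    refine sum_congr rfl fun j _ => sum_congr rfl fun k _ => ?_
    push_cast
    ring
  rw [hsum, hsplit] at hErr
  have hre := neg_le_of_abs_le ((Complex.abs_re_le_norm _).trans hErr)
  rw [Complex.sub_re, Complex.div_ofReal_re] at hre
  have hdiv : ε * S / ((m : ℝ) + 1) ≤ T.re / ((m : ℝ) + 1) := by gcongr
  have hrw : (ε - (n : ℝ) * (n + 1) * C / ((m : ℝ) - n)) * S / ((m : ℝ) + 1) =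
      ε * S / ((m : ℝ) + 1) - n * (n + 1) * K * S := by
    rw [hK]
    field_simp
  linarith

/-- Key positivity step in the proof of Theorem 2.1 of the paper: the averaged matrix
representation `P_{m₁}(z₂)` of a strictly positive bivariate Laurent polynomial (i) represents
`P` via `P(z₁,z₂) = 𝐳₁† P_{m₁}(z₂) 𝐳₁`, and (ii) is positive definite once
`n₁(n₁+1)C₁/(m₁−n₁) < ε`, with the explicit lower bound
`x† P_{m₁}(z₂) x ≥ (ε − n₁(n₁+1)C₁/(m₁−n₁)) ‖x‖²/(m₁+1)`. -/
theorem stmt_13 (n₁ n₂ : ℕ) (c : ℤ → ℤ → ℂ)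
    (hband : ∀ k : ℤ, |k| > (n₁ : ℤ) → ∀ l : ℤ, c k l = 0)
    (p : ℤ → ℂ → ℂ)
    (hp : ∀ (k : ℤ) (z₂ : ℂ), p k z₂ = ∑ l ∈ Finset.Icc (-(n₂ : ℤ)) n₂, c k l * z₂ ^ l)
    (P : ℂ → ℂ → ℂ)
    (hP : ∀ z₁ z₂ : ℂ, P z₁ z₂ = ∑ k ∈ Finset.Icc (-(n₁ : ℤ)) n₁, p k z₂ * z₁ ^ k)
    (ε : ℝ) (hε : 0 < ε)
    (hpos : ∀ z₁ z₂ : ℂ, ‖z₁‖ = 1 → ‖z₂‖ = 1 → (P z₁ z₂).im = 0 ∧ ε ≤ (P z₁ z₂).re)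
    (C₁ : ℝ)
    (hC₁ : ∀ k ∈ Finset.Icc (-(n₁ : ℤ)) n₁, ∀ z₂ : ℂ, ‖z₂‖ = 1 → ‖p k z₂‖ ≤ C₁)
    (m₁ : ℕ) (hm₁ : n₁ < m₁)
    (hgap : (n₁ : ℝ) * (n₁ + 1) * C₁ / ((m₁ : ℝ) - n₁) < ε)
    (Pm : ℂ → Matrix (Fin (m₁ + 1)) (Fin (m₁ + 1)) ℂ)
    (hPm : ∀ z₂ : ℂ, Pm z₂ = Matrix.of (fun j k : Fin (m₁ + 1) =>
      if |(j : ℤ) - (k : ℤ)| ≤ (n₁ : ℤ) then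
        p ((k : ℤ) - (j : ℤ)) z₂ / ((m₁ : ℂ) + 1 - |((j : ℤ) - (k : ℤ) : ℤ)|)
      else 0)) :
    (∀ z₁ z₂ : ℂ, ‖z₁‖ = 1 → ‖z₂‖ = 1 →
      P z₁ z₂ = ∑ j : Fin (m₁ + 1), ∑ k : Fin (m₁ + 1),
        starRingEnd ℂ (z₁ ^ (j : ℕ)) * Pm z₂ j k * z₁ ^ (k : ℕ)) ∧
    (∀ z₂ : ℂ, ‖z₂‖ = 1 → ∀ x : Fin (m₁ + 1) → ℂ,
      ((ε - (n₁ : ℝ) * (n₁ + 1) * C₁ / ((m₁ : ℝ) - n₁)) * (∑ j, ‖x j‖ ^ 2)) / ((m₁ : ℝ) + 1) ≤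
        (∑ j : Fin (m₁ + 1), ∑ k : Fin (m₁ + 1),
          starRingEnd ℂ (x j) * Pm z₂ j k * x k).re ∧
      (x ≠ 0 →
        0 < ((ε - (n₁ : ℝ) * (n₁ + 1) * C₁ / ((m₁ : ℝ) - n₁)) * (∑ j, ‖x j‖ ^ 2)) /
          ((m₁ : ℝ) + 1))) ∧
    (∀ z₂ : ℂ, ‖z₂‖ = 1 → (Pm z₂).PosDef) := by
  have hsupp : ∀ (z₂ : ℂ) (d : ℤ), (n₁ : ℤ) < |d| → p d z₂ = 0 := fun z₂ d hd => by
    rw [hp]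
    exact sum_eq_zero fun l _ => by rw [hband d hd l, zero_mul]
  have hPm' : ∀ z₂, Pm z₂ = averagedMatrix m₁ fun d => p d z₂ := fun z₂ => by
    rw [hPm]
    ext j k
    simp only [averagedMatrix, Matrix.of_apply]
    rw [abs_sub_comm (j : ℤ)]
    split_ifs with h
    · rfl
    · rw [hsupp z₂ _ (not_le.1 h), zero_div]
  have hbound : ∀ z₂ : ℂ, ‖z₂‖ = 1 → ∀ d, ‖p d z₂‖ ≤ C₁ := fun z₂ hz₂ d => by
    rcases le_or_gt |d| (n₁ : ℤ) with h | h
    · exact hC₁ d (mem_Icc.2 (abs_le.1 h)) z₂ hz₂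
    · rw [hsupp z₂ d h, norm_zero]
      exact (norm_nonneg _).trans (hC₁ 0 (by simp) z₂ hz₂)
  have hposP : ∀ z₂ : ℂ, ‖z₂‖ = 1 → ∀ z : ℂ, ‖z‖ = 1 →
      (∑ d ∈ Icc (-(n₁ : ℤ)) n₁, p d z₂ * z ^ d).im = 0 ∧
        ε ≤ (∑ d ∈ Icc (-(n₁ : ℤ)) n₁, p d z₂ * z ^ d).re := fun z₂ hz₂ z hz => by
    rw [← hP]
    exact hpos z z₂ hz hz₂
  have hlower : ∀ z₂ : ℂ, ‖z₂‖ = 1 → ∀ x : Fin (m₁ + 1) → ℂ,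
      ((ε - (n₁ : ℝ) * (n₁ + 1) * C₁ / ((m₁ : ℝ) - n₁)) * (∑ j, ‖x j‖ ^ 2)) / ((m₁ : ℝ) + 1) ≤
        (∑ j, ∑ k, starRingEnd ℂ (x j) * Pm z₂ j k * x k).re := fun z₂ hz₂ x => by
    rw [hPm']
    exact le_averagedMatrix_form_re hm₁ _ (hsupp z₂) (hbound z₂ hz₂) (hposP z₂ hz₂) x
  have hlower_pos : ∀ x : Fin (m₁ + 1) → ℂ, x ≠ 0 →
      0 < ((ε - (n₁ : ℝ) * (n₁ + 1) * C₁ / ((m₁ : ℝ) - n₁)) * (∑ j, ‖x j‖ ^ 2)) /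
        ((m₁ : ℝ) + 1) := fun x hx => by
    obtain ⟨i, hi⟩ := Function.ne_iff.1 hx
    have hS : 0 < ∑ j, ‖x j‖ ^ 2 :=
      sum_pos' (fun j _ => by positivity) ⟨i, mem_univ i, pow_pos (norm_pos_iff.2 hi) 2⟩
    have := sub_pos.2 hgap
    positivity
  refine ⟨fun z₁ z₂ hz₁ _ => ?_, fun z₂ hz₂ x => ⟨hlower z₂ hz₂ x, hlower_pos x⟩,
    fun z₂ hz₂ => ?_⟩
  · rw [hPm', sum_averagedMatrix_zpow hm₁.le _ (hsupp z₂) hz₁, hP]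
  · have hH : (Pm z₂).IsHermitian := by
      rw [hPm']
      exact averagedMatrix_isHermitian _ fun d =>
        conj_laurent_coeff (fun d => p d z₂) (hsupp z₂) (fun z hz => (hposP z₂ hz₂ z hz).1) d
    refine Matrix.PosDef.of_dotProduct_mulVec_pos hH fun x hx => ?_
    have hform : star x ⬝ᵥ (Pm z₂).mulVec x =
        ∑ j, ∑ k, starRingEnd ℂ (x j) * Pm z₂ j k * x k := by
      simp only [dotProduct, Matrix.mulVec, mul_sum, mul_assoc, Pi.star_apply, RCLike.star_def]
    have him : (star x ⬝ᵥ (Pm z₂).mulVec x).im = 0 := hH.im_star_dotProduct_mulVec_self x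
    refine Complex.lt_def.2 ⟨?_, him.symm⟩
    rw [hform]
    exact (hlower_pos x hx).trans_le (hlower z₂ hz₂ x)
end
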